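/- Suppose S is smooth, let 1 ≤ i ≤ n−p, and suppose that for a generic choice of a ∈ ℂ^{(n−p−i+1)×n} the classic polar variety W_{K^{n−p−i}(\underline a)}(S) is nonempty. Then for a generic choice of a, the variety H_i is nonempty, smooth, and equidimensional of dimension n−p−i, and the image of the canonical projection ω_i : H_i → ℂⁿ equals W_{K^{n−p−i}(\underline a)}(S) ∩ S_reg; moreover there exists a Zariski dense open subset U of W_{K^{n−p−i}(\underline a)}(S) such that the ω_i-fiber of every x ∈ U is zero-dimensional. -/

import Mathlib

open MvPolynomial

noncomputable section

/-- The Zariski closure of a subset of the affine space `σ → ℂ`. -/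
def zcl {σ : Type} (T : Set (σ → ℂ)) : Set (σ → ℂ) :=
  MvPolynomial.zeroLocus ℂ (MvPolynomial.vanishingIdeal ℂ T)

/-- Zariski open subsets of the affine space `σ → ℂ`. -/
def ZOpen {σ : Type} (U : Set (σ → ℂ)) : Prop :=
  ∃ I : Ideal (MvPolynomial σ ℂ), U = {x | ∃ f ∈ I, MvPolynomial.eval x f ≠ 0}

/-- Zariski open subsets of the space of `m × n` complex matrices. -/
def ZOpenMat {m n : ℕ} (U : Set (Matrix (Fin m) (Fin n) ℂ)) : Prop :=
  ∃ I : Ideal (MvPolynomial (Fin m × Fin n) ℂ),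
    U = {a | ∃ f ∈ I, MvPolynomial.eval (fun q => a q.1 q.2) f ≠ 0}

/-- `T` is of pure dimension `d`: every irreducible component of (the Zariski closure of) `T`,
i.e. every minimal prime over its vanishing ideal, has coordinate ring of Krull dimension `d`. -/
def IsPureDim {σ : Type} (T : Set (σ → ℂ)) (d : ℕ) : Prop :=
  ∀ P ∈ (MvPolynomial.vanishingIdeal ℂ T).minimalPrimes,
    ringKrullDim (MvPolynomial σ ℂ ⧸ P) = (d : WithBot (WithTop ℕ))

/-- The Zariski tangent space at a point `x` of (the Zariski closure of) a subset `T`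
of affine space: the common kernel of the differentials at `x` of all polynomials
vanishing on `T`. -/
def tangentAt {σ : Type} [Fintype σ] [DecidableEq σ] (T : Set (σ → ℂ)) (x : σ → ℂ) :
    Submodule ℂ (σ → ℂ) :=
  ⨅ (f : MvPolynomial σ ℂ) (_ : f ∈ MvPolynomial.vanishingIdeal ℂ T),
    LinearMap.ker
      (∑ l, MvPolynomial.eval x (MvPolynomial.pderiv l f) •
        (LinearMap.proj l : (σ → ℂ) →ₗ[ℂ] ℂ))

/-- `rs` is a regular sequence in the commutative ring `R`. -/
def IsRegSeq {R : Type*} [CommRing R] (rs : List R) : Prop :=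
  Ideal.span {x | x ∈ rs} ≠ ⊤ ∧
  ∀ j, j < rs.length → ∀ b : R,
    rs.getD j 0 * b ∈ Ideal.span {x | x ∈ rs.take j} →
    b ∈ Ideal.span {x | x ∈ rs.take j}

/-- The common zero set in `ℂⁿ` of polynomials `F₁, …, F_p ∈ ℚ[X₁, …, Xₙ]`. -/
def zeroSetC {n p : ℕ} (F : Fin p → MvPolynomial (Fin n) ℚ) : Set (Fin n → ℂ) :=
  {x | ∀ k, MvPolynomial.aeval x (F k) = 0}

/-- The Jacobian matrix `[∂F_k/∂X_l]` evaluated at `x ∈ ℂⁿ`. -/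
def jacC {n p : ℕ} (F : Fin p → MvPolynomial (Fin n) ℚ) (x : Fin n → ℂ) :
    Matrix (Fin p) (Fin n) ℂ :=
  Matrix.of fun k l => MvPolynomial.aeval x (MvPolynomial.pderiv l (F k))

/-- The set of regular points of `S = {F₁ = 0, …, F_p = 0}`: points of `S` where the
Jacobian has maximal rank `p`. -/
def SregC {n p : ℕ} (F : Fin p → MvPolynomial (Fin n) ℚ) : Set (Fin n → ℂ) :=
  {x | x ∈ zeroSetC F ∧ (jacC F x).rank = p}

/-- The classic polar variety: the Zariski closure of the locus of regular points of `S`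
where the matrix obtained by appending the rows of `a` to the Jacobian has rank at
most `r` (i.e. where all `(r+1)`-minors vanish). -/
def Wclassic {n p m : ℕ} (F : Fin p → MvPolynomial (Fin n) ℚ)
    (a : Matrix (Fin m) (Fin n) ℂ) (r : ℕ) : Set (Fin n → ℂ) :=
  zcl {x | x ∈ SregC F ∧ (Matrix.fromRows (jacC F x) a).rank ≤ r}

/-- The dual polar variety: as `Wclassic`, with appended rows `(a_{k,1} - X₁, …, a_{k,n} - Xₙ)`. -/
def Wdual {n p m : ℕ} (F : Fin p → MvPolynomial (Fin n) ℚ)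
    (a : Matrix (Fin m) (Fin n) ℂ) (r : ℕ) : Set (Fin n → ℂ) :=
  zcl {x | x ∈ SregC F ∧
    (Matrix.fromRows (jacC F x) (Matrix.of fun k l => a k l - x l)).rank ≤ r}

/-- `F₁, …, F_p` generate the full vanishing ideal of their zero set (over `ℂ`);
this encodes that `(F₁, …, F_p)` is reduced (radical) and the ideal of definition of `S`. -/
def idealOfDef {n p : ℕ} (F : Fin p → MvPolynomial (Fin n) ℚ) : Prop :=
  MvPolynomial.vanishingIdeal ℂ (zeroSetC F) =
    Ideal.span (Set.range fun k => MvPolynomial.map (algebraMap ℚ ℂ) (F k))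

/-- The submatrix of the first `m` rows of a matrix. -/
def firstRows {N n' m : ℕ} (a : Matrix (Fin N) (Fin n') ℂ) (h : m ≤ N) :
    Matrix (Fin m) (Fin n') ℂ :=
  Matrix.of fun k l => a (Fin.castLE h k) l

/-- The matrix obtained by deleting row `h`. -/
def rowErase {m n' : ℕ} (a : Matrix (Fin (m + 1)) (Fin n') ℂ) (h : Fin (m + 1)) :
    Matrix (Fin m) (Fin n') ℂ :=
  Matrix.of fun k l => a (h.succAbove k) l

/-- The real trace `S_ℝ := S ∩ ℝⁿ`, as a subset of Euclidean space. -/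
def SR {n p : ℕ} (F : Fin p → MvPolynomial (Fin n) ℚ) : Set (EuclideanSpace ℝ (Fin n)) :=
  {x | (fun j => (x j : ℂ)) ∈ zeroSetC F}

/-- `C` is a connected component of `T`. -/
def IsConnCompOf {α : Type*} [TopologicalSpace α] (C T : Set α) : Prop :=
  C.Nonempty ∧ C ⊆ T ∧ IsPreconnected C ∧
    ∀ D, C ⊆ D → D ⊆ T → IsPreconnected D → D = C

end

/-- The affine cone over the variety `H_i` attached to a fixed matrix `a`: pairs
`(x, (λ, θ))` (flattened) with `x ∈ S_reg`, `(λ, θ) ≠ 0` and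
`J(F)(x)ᵀ·λᵀ + aᵀ·θᵀ = 0`. -/
def HconeA {n p m : ℕ} (F : Fin p → MvPolynomial (Fin n) ℚ)
    (a : Matrix (Fin m) (Fin n) ℂ) : Set ((Fin n ⊕ (Fin p ⊕ Fin m)) → ℂ) :=
  {q | (fun l => q (Sum.inl l)) ∈ SregC F ∧
    (fun s => q (Sum.inr s)) ≠ (0 : Fin p ⊕ Fin m → ℂ) ∧
    Matrix.vecMul (fun s => q (Sum.inr s))
      (Matrix.fromRows (jacC F fun l => q (Sum.inl l)) a) = 0}

/-- The fiber of the canonical projection `ω_i : H_i → ℂⁿ` over `x`, as a set of points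
of the projective space `ℙ^{n-i}`. -/
noncomputable def omegaFiber {n p m : ℕ} (F : Fin p → MvPolynomial (Fin n) ℚ)
    (a : Matrix (Fin m) (Fin n) ℂ) (x : Fin n → ℂ) :
    Set (Projectivization ℂ (Fin p ⊕ Fin m → ℂ)) :=
  {w | Matrix.vecMul w.rep (Matrix.fromRows (jacC F x) a) = 0}

theorem formallyEtale_of_isAlgebraic (S K : Type*) [CommRing S] [IsDomain S] [Field K]
    [Algebra S K] [FaithfulSMul S K] [Algebra.IsAlgebraic S K] [CharZero K] :
    Algebra.FormallyEtale S K := by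
  let : Algebra (FractionRing S) K := FractionRing.liftAlgebra S K
  have : IsScalarTower S (FractionRing S) K := FractionRing.isScalarTower_liftAlgebra S K
  have : Algebra.IsAlgebraic (FractionRing S) K :=
    .extendScalars (IsFractionRing.injective S (FractionRing S))
  have : CharZero (FractionRing S) := (algebraMap (FractionRing S) K).charZero_iff
    (algebraMap (FractionRing S) K).injective |>.2 inferInstance
  have : Algebra.FormallyEtale S (FractionRing S) :=
    .of_isLocalization (nonZeroDivisors S)
  have : Algebra.FormallyEtale (FractionRing S) K := .of_isSeparable _ _
  exact .comp S (FractionRing S) K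

theorem existsUnique_derivation_extension (R S T : Type*) [CommRing R] [CommRing S] [CommRing T]
    [Algebra R S] [Algebra R T] [Algebra S T] [IsScalarTower R S T] [Algebra.FormallyEtale S T]
    (d : Derivation R S T) :
    ∃! D : Derivation R T T, ∀ s, D (algebraMap S T s) = d s := by
  let e := KaehlerDifferential.tensorKaehlerEquivOfFormallyEtale R S T
  have hD : ∀ D : Derivation R T T, ∀ s,
      D (algebraMap S T s) = D.liftKaehlerDifferential (e (1 ⊗ₜ KaehlerDifferential.D R S s)) := by
    intro D s
    rw [← KaehlerDifferential.tensorKaehlerEquivOfFormallyEtale_symm_D_algebraMap R S T s]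
    simp [e]
  refine ⟨((LinearMap.liftBaseChange T d.liftKaehlerDifferential) ∘ₗ
    e.symm.toLinearMap).compDer (KaehlerDifferential.D R T), ?_, ?_⟩
  · intro s
    simp [e, KaehlerDifferential.tensorKaehlerEquivOfFormallyEtale_symm_D_algebraMap]
  · intro D hDs
    ext t
    have key : D.liftKaehlerDifferential ∘ₗ e.toLinearMap =
        LinearMap.liftBaseChange T d.liftKaehlerDifferential := by
      refine (LinearMap.liftBaseChangeEquiv T).symm.injective ?_
      refine Derivation.liftKaehlerDifferential_unique _ _ ?_
      ext s
      have h1 := hD D s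
      rw [hDs] at h1
      simpa using h1.symm
    have := LinearMap.congr_fun key (e.symm (KaehlerDifferential.D R T t))
    simpa using this

theorem IsTranscendenceBasis.existsUnique_derivation {k K ι : Type*} [Field k] [Field K]
    [CharZero K] [Algebra k K] {x : ι → K} (hx : IsTranscendenceBasis k x) (c : ι → K) :
    ∃! D : Derivation k K K, ∀ i, D (x i) = c i := by
  let : Algebra (MvPolynomial ι k) K := (aeval x).toRingHom.toAlgebra
  have hmap : ∀ f, algebraMap (MvPolynomial ι k) K f = aeval x f := fun _ => rfl
  have : IsScalarTower k (MvPolynomial ι k) K := .of_algebraMap_eq fun r => by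
    rw [hmap]; simp
  have : FaithfulSMul (MvPolynomial ι k) K := (faithfulSMul_iff_algebraMap_injective _ _).2 hx.1
  have : Algebra.IsAlgebraic (MvPolynomial ι k) K := by
    have := hx.isAlgebraic
    exact (Algebra.isAlgebraic_ringHom_iff_of_comp_eq hx.1.aevalEquiv (RingEquiv.refl K)
      (by ext <;> simp [hmap])).1 this
  have := formallyEtale_of_isAlgebraic (MvPolynomial ι k) K
  obtain ⟨D, hD, huniq⟩ :=
    existsUnique_derivation_extension k (MvPolynomial ι k) K (mkDerivation k c)
  refine ⟨D, fun i => ?_, fun D' hD' => huniq D' ?_⟩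
  · simpa [hmap, mkDerivation_X] using hD (X i)
  · have : D'.compAlgebraMap (MvPolynomial ι k) = mkDerivation k c :=
      derivation_ext fun i => by simpa [hmap, mkDerivation_X] using hD' i
    intro s
    rw [← this]; rfl

theorem Derivation.map_aeval_mvPolynomial {k A M σ : Type*} [CommSemiring k]
    [CommSemiring A] [Algebra k A] [AddCommMonoid M] [Module A M] [Module k M]
    [IsScalarTower k A M] [Fintype σ]
    (D : Derivation k A M) (x : σ → A) (f : MvPolynomial σ k) :
    D (aeval x f) = ∑ i, aeval x (pderiv i f) • D (x i) := by
  classical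
  induction f using MvPolynomial.induction_on with
  | C r => simp
  | add f g hf hg => simp [hf, hg, add_smul, Finset.sum_add_distrib]
  | mul_X f j hf =>
    simp only [map_mul, aeval_X, Derivation.leibniz, hf, pderiv_X, Pi.single_apply, map_add,
      add_smul, Finset.sum_add_distrib, Finset.smul_sum, smul_eq_mul, mul_ite, mul_one, mul_zero,
      mul_smul, apply_ite (aeval x), map_zero, ite_smul, zero_smul, Finset.sum_ite_eq,
      Finset.mem_univ, if_true]

theorem exists_specialization {σ K : Type*} [Finite σ] [Field K] [Algebra ℂ K]
    (x : σ → K) {f : MvPolynomial σ ℂ} (hf : aeval x f ≠ 0) :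
    ∃ z : σ → ℂ, eval z f ≠ 0 ∧ ∀ g : MvPolynomial σ ℂ, aeval x g = 0 → eval z g = 0 := by
  set P := RingHom.ker (aeval (R := ℂ) x) with hP
  have hprime : P.IsPrime := RingHom.ker_isPrime _
  have h1 := (vanishingIdeal_zeroLocus_eq_radical (K := ℂ) P).trans hprime.radical
  have h2 : f ∉ P := hf
  rw [← h1, mem_vanishingIdeal_iff] at h2
  push Not at h2
  obtain ⟨z, hz, hzf⟩ := h2
  rw [mem_zeroLocus_iff] at hz
  exact ⟨z, by simpa using hzf, fun g hg => by simpa using hz g hg⟩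

theorem exists_ne_zero_forall_eval_eq_zero {α β : Type} [Finite α] [Finite β]
    (E : Set (MvPolynomial (α ⊕ β) ℂ)) (b : MvPolynomial (α ⊕ β) ℂ)
    (h : ∀ (K : Type) [Field K] [Algebra ℂ K] (u : α → K) (a : β → K),
      AlgebraicIndependent ℂ a → (∀ e ∈ E, aeval (Sum.elim u a) e = 0) →
      aeval (Sum.elim u a) b = 0) :
    ∃ g : MvPolynomial β ℂ, g ≠ 0 ∧ ∀ (u : α → ℂ) (a : β → ℂ), eval a g ≠ 0 →
      (∀ e ∈ E, eval (Sum.elim u a) e = 0) → eval (Sum.elim u a) b = 0 := by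
  let R := MvPolynomial (α ⊕ β) ℂ
  let N : Submonoid R :=
    ((nonZeroDivisors (MvPolynomial β ℂ)).map (rename Sum.inr : MvPolynomial β ℂ →ₐ[ℂ] R)) ⊔
      Submonoid.powers b
  by_cases hd : Disjoint (Ideal.span E : Set R) N
  · exfalso
    obtain ⟨P, hP, hEP, hPN⟩ := Ideal.exists_le_prime_disjoint _ N hd
    let K := FractionRing (R ⧸ P)
    let φ : R →ₐ[ℂ] K := (Algebra.ofId (R ⧸ P) K |>.restrictScalars ℂ).comp (Ideal.Quotient.mkₐ ℂ P)
    have hφ : ∀ f, φ f = 0 ↔ f ∈ P := fun f => by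
      change algebraMap (R ⧸ P) K (Ideal.Quotient.mk P f) = 0 ↔ _
      rw [FaithfulSMul.algebraMap_eq_zero_iff, Ideal.Quotient.eq_zero_iff_mem]
    have hφ' : φ = aeval (Sum.elim (fun i => φ (X (Sum.inl i))) fun j => φ (X (Sum.inr j))) := by
      ext i; rcases i with i | i <;> simp
    have hb := h K (fun i => φ (X (Sum.inl i))) (fun j => φ (X (Sum.inr j))) ?_ ?_
    · rw [← hφ', hφ] at hb
      exact Set.disjoint_left.1 hPN hb
        (Submonoid.mem_sup_right (Submonoid.mem_powers b))
    · rw [algebraicIndependent_iff]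
      intro g hg
      by_contra hg0
      have : φ (rename Sum.inr g) = 0 := by
        rw [hφ', aeval_rename, ← hg]; congr 2
      rw [hφ] at this
      exact Set.disjoint_left.1 hPN this (Submonoid.mem_sup_left
        (Submonoid.mem_map_of_mem _ (mem_nonZeroDivisors_of_ne_zero hg0)))
    · intro e he
      rw [← hφ', hφ]
      exact hEP (Ideal.subset_span he)
  · obtain ⟨f, hfE, hfN⟩ := Set.not_disjoint_iff.1 hd
    obtain ⟨_, ⟨g, hg, rfl⟩, _, ⟨k, rfl⟩, rfl⟩ := Submonoid.mem_sup.1 hfN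
    refine ⟨g, nonZeroDivisors.ne_zero hg, fun u a hga hE => ?_⟩
    have h0 : Ideal.span E ≤ RingHom.ker (eval (Sum.elim u a)) := Ideal.span_le.2 hE
    have h1 := h0 hfE
    rw [RingHom.mem_ker, map_mul, map_pow] at h1
    have h2 : eval (Sum.elim u a) (rename Sum.inr g) = eval a g := by
      rw [eval_rename]; rfl
    rcases mul_eq_zero.1 h1 with h3 | h3
    · exact absurd (h2.symm.trans h3) hga
    · exact eq_zero_of_pow_eq_zero h3

theorem eq_zero_of_sum_mul_aeval_pderiv_eq_zero {σ κ K : Type*} [Fintype σ] [Fintype κ] [Field K]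
    [Algebra ℂ K] (G : κ → MvPolynomial σ ℂ) (E : Set (MvPolynomial σ ℂ)) (h : MvPolynomial σ ℂ)
    (hJ : ∀ z : σ → ℂ, (∀ e ∈ E, eval z e = 0) → eval z h ≠ 0 →
      ∀ y : κ → ℂ, (∀ j, ∑ k, y k * eval z (pderiv j (G k)) = 0) → y = 0)
    (x : σ → K) (hE : ∀ e ∈ E, aeval x e = 0) (hh : aeval x h ≠ 0) (y : κ → K)
    (hy : ∀ j, ∑ k, y k * aeval x (pderiv j (G k)) = 0) : y = 0 := by
  by_contra hy0
  obtain ⟨k₀, hk₀⟩ := Function.ne_iff.1 hy0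
  have hl : ∀ g : MvPolynomial σ ℂ, aeval (Sum.elim x y) (rename Sum.inl g) = aeval x g :=
    fun g => by rw [aeval_rename, Sum.elim_comp_inl]
  have hl' : ∀ (z : σ ⊕ κ → ℂ) (g : MvPolynomial σ ℂ),
      eval z (rename Sum.inl g) = eval (z ∘ Sum.inl) g := fun z g => by rw [eval_rename]
  obtain ⟨z, hz0, hz⟩ := exists_specialization (Sum.elim x y)
    (f := rename Sum.inl h * X (Sum.inr k₀)) (by simpa [hl] using ⟨hh, hk₀⟩)
  rw [map_mul, mul_ne_zero_iff, hl', eval_X] at hz0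
  refine hz0.2 (congrFun (hJ (z ∘ Sum.inl) (fun e he => ?_) hz0.1 (z ∘ Sum.inr) fun j => ?_) k₀)
  · rw [← hl']; exact hz _ (by rw [hl, hE e he])
  · have := hz (∑ k, X (Sum.inr k) * rename Sum.inl (pderiv j (G k))) (by simpa [hl] using hy j)
    simp only [map_sum, map_mul, eval_X, hl'] at this
    exact this

theorem generic_transversality_field {ι τ μ K : Type*} [Fintype ι] [Fintype τ] [Fintype μ]
    [Field K] [Algebra ℂ K] (f : ι → MvPolynomial τ ℂ) (x : τ → K) (lam : ι → K) (θ : μ → K)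
    (a : μ × τ → K) (ha : AlgebraicIndependent ℂ a) (hx : ∀ k, aeval x (f k) = 0)
    (hJ : ∀ y : ι → K, (∀ l, ∑ k, y k * aeval x (pderiv l (f k)) = 0) → y = 0)
    (hv : ∀ l, ∑ k, lam k * aeval x (pderiv l (f k)) + ∑ j, θ j * a (j, l) = 0)
    (η : τ → K) (hη : ∀ k, ∑ l, aeval x (pderiv l (f k)) * η l = 0)
    (haη : ∀ j, ∑ l, a (j, l) * η l = 0) (y : ι → K)
    (hy : ∀ j, ∑ k, y k * aeval x (pderiv j (f k)) +
      ∑ k, ∑ l, lam k * aeval x (pderiv j (pderiv l (f k))) * η l = 0) :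
    (lam = 0 ∧ θ = 0) ∨ (y = 0 ∧ η = 0) := by
  classical
  have : CharZero K := (algebraMap ℂ K).charZero_iff (algebraMap ℂ K).injective |>.1 inferInstance
  have key : ∀ j₀ l₀, θ j₀ * η l₀ = 0 := by
    intro j₀ l₀
    obtain ⟨s, has, hs⟩ := exists_isTranscendenceBasis_superset ha.coe_range
    obtain ⟨D, hD, -⟩ := hs.existsUnique_derivation
      (fun t : s => if (t : K) = a (j₀, l₀) then 1 else 0)
    have hDa : ∀ j l, D (a (j, l)) = if (j, l) = (j₀, l₀) then 1 else 0 := fun j l => by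
      simpa [ha.injective.eq_iff] using hD ⟨a (j, l), has ⟨_, rfl⟩⟩
    have hDx : ∀ k, ∑ l, aeval x (pderiv l (f k)) * D (x l) = 0 := fun k => by
      simpa [hx k] using (D.map_aeval_mvPolynomial x (f k)).symm
    have hDv : ∀ l, ∑ k, (lam k * ∑ j, aeval x (pderiv j (pderiv l (f k))) * D (x j) +
        aeval x (pderiv l (f k)) * D (lam k)) +
        ∑ j, (θ j * D (a (j, l)) + a (j, l) * D (θ j)) = 0 := fun l => by
      simpa [D.map_aeval_mvPolynomial x] using congrArg D (hv l)
    have h1 : ∑ l, η l * (∑ k, lam k * ∑ j, aeval x (pderiv j (pderiv l (f k))) * D (x j)) = 0 := by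
      calc _ = ∑ j, D (x j) * ∑ k, ∑ l, lam k * aeval x (pderiv j (pderiv l (f k))) * η l := by
            simp only [Finset.mul_sum]
            rw [Finset.sum_congr rfl fun l _ => Finset.sum_comm, Finset.sum_comm]
            refine Finset.sum_congr rfl fun j _ => ?_
            rw [Finset.sum_comm]
            refine Finset.sum_congr rfl fun k _ => Finset.sum_congr rfl fun l _ => by ring
        _ = ∑ j, D (x j) * -∑ k, y k * aeval x (pderiv j (f k)) :=
            Finset.sum_congr rfl fun j _ => by rw [eq_neg_of_add_eq_zero_right (hy j)]
        _ = -∑ k, y k * ∑ j, aeval x (pderiv j (f k)) * D (x j) := by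
            simp only [Finset.mul_sum, mul_neg, Finset.sum_neg_distrib]
            rw [Finset.sum_comm]
            congr 1
            refine Finset.sum_congr rfl fun k _ => Finset.sum_congr rfl fun l _ => by ring
        _ = 0 := by simp [hDx]
    have h2 : ∑ l, η l * (∑ k, aeval x (pderiv l (f k)) * D (lam k)) = 0 := by
      calc _ = ∑ k, D (lam k) * ∑ l, aeval x (pderiv l (f k)) * η l := by
            simp only [Finset.mul_sum]
            rw [Finset.sum_comm]
            refine Finset.sum_congr rfl fun k _ => Finset.sum_congr rfl fun l _ => by ring
        _ = 0 := by simp [hη]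
    have h3 : ∑ l, η l * (∑ j, a (j, l) * D (θ j)) = 0 := by
      calc _ = ∑ j, D (θ j) * ∑ l, a (j, l) * η l := by
            simp only [Finset.mul_sum]
            rw [Finset.sum_comm]
            refine Finset.sum_congr rfl fun k _ => Finset.sum_congr rfl fun l _ => by ring
        _ = 0 := by simp [haη]
    have h4 : ∑ l, η l * (∑ j, θ j * D (a (j, l))) = θ j₀ * η l₀ := by
      simp only [hDa, Prod.mk.injEq, ite_and, mul_ite, mul_one, mul_zero, Finset.sum_ite_eq',
        Finset.mem_univ, if_true]
      exact mul_comm _ _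
    have h5 := Finset.sum_congr rfl fun l (_ : l ∈ Finset.univ) => congrArg (η l * ·) (hDv l)
    simp only [Finset.sum_add_distrib, mul_add, h1, h2, h3, h4] at h5
    simpa using h5
  by_cases hθ : θ = 0
  · subst hθ
    exact Or.inl ⟨hJ lam (by simpa using hv), rfl⟩
  · obtain ⟨j₀, hj₀⟩ := Function.ne_iff.1 hθ
    have hη0 : η = 0 := funext fun l => (mul_eq_zero.1 (key j₀ l)).resolve_left hj₀
    subst hη0
    exact Or.inr ⟨hJ y (by simpa using hy), rfl⟩


theorem exists_generic_transversality {ι τ μ : Type} [Fintype ι] [Fintype τ] [Fintype μ]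
    (f : ι → MvPolynomial τ ℂ)
    (hJ : ∀ z : τ → ℂ, (∀ k, eval z (f k) = 0) →
      ∀ y : ι → ℂ, (∀ l, ∑ k, y k * eval z (pderiv l (f k)) = 0) → y = 0) :
    ∃ g : MvPolynomial (μ × τ) ℂ, g ≠ 0 ∧ ∀ (a : μ × τ → ℂ), eval a g ≠ 0 →
      ∀ (x : τ → ℂ) (v : ι ⊕ μ → ℂ) (η : τ → ℂ) (y : ι → ℂ), (∀ k, eval x (f k) = 0) →
      (∀ l, ∑ k, v (.inl k) * eval x (pderiv l (f k)) + ∑ j, v (.inr j) * a (j, l) = 0) →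
      (∀ k, ∑ l, eval x (pderiv l (f k)) * η l = 0) → (∀ j, ∑ l, a (j, l) * η l = 0) →
      (∀ j, ∑ k, y k * eval x (pderiv j (f k)) +
        ∑ k, ∑ l, v (.inl k) * eval x (pderiv j (pderiv l (f k))) * η l = 0) →
      v = 0 ∨ (y = 0 ∧ η = 0) := by
  classical
  let R := MvPolynomial ((τ ⊕ (ι ⊕ μ) ⊕ (ι ⊕ τ)) ⊕ (μ × τ)) ℂ
  let r : MvPolynomial τ ℂ →ₐ[ℂ] R := rename (Sum.inl ∘ Sum.inl)
  let V : ι ⊕ μ → R := fun s => X (.inl (.inr (.inl s)))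
  let Y : ι → R := fun s => X (.inl (.inr (.inr (.inl s))))
  let H : τ → R := fun s => X (.inl (.inr (.inr (.inr s))))
  let A : μ × τ → R := fun s => X (.inr s)
  let E : Set R := Set.range (fun k => r (f k)) ∪
    (Set.range (fun l => ∑ k, V (.inl k) * r (pderiv l (f k)) + ∑ j, V (.inr j) * A (j, l)) ∪
    (Set.range (fun k => ∑ l, r (pderiv l (f k)) * H l) ∪
    (Set.range (fun j => ∑ l, A (j, l) * H l) ∪
    Set.range (fun j => ∑ k, Y k * r (pderiv j (f k)) +
        ∑ k, ∑ l, V (.inl k) * r (pderiv j (pderiv l (f k))) * H l))))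
  have hcase : ∀ (s : ι ⊕ μ) (t : ι ⊕ τ), ∃ g : MvPolynomial (μ × τ) ℂ, g ≠ 0 ∧
      ∀ (u : τ ⊕ (ι ⊕ μ) ⊕ (ι ⊕ τ) → ℂ) (a : μ × τ → ℂ), eval a g ≠ 0 →
      (∀ e ∈ E, eval (Sum.elim u a) e = 0) → u (.inr (.inl s)) * u (.inr (.inr t)) = 0 := by
    intro s t
    suffices hK : _ by
      obtain ⟨g, hg, hg'⟩ := exists_ne_zero_forall_eval_eq_zero E
        (X (.inl (.inr (.inl s))) * X (.inl (.inr (.inr t)))) hK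
      exact ⟨g, hg, fun u a h1 h2 => by simpa using hg' u a h1 h2⟩
    intro K _ _ u a ha hE
    have hr : ∀ q, aeval (Sum.elim u a) (r q) = aeval (u ∘ Sum.inl) q := fun q => by
      change aeval _ (rename _ q) = _
      rw [aeval_rename]; rfl
    simp only [E, Set.mem_union, or_imp, forall_and, Set.forall_mem_range, map_add, map_sum,
      map_mul, hr, V, Y, H, A, aeval_X, Sum.elim_inl, Sum.elim_inr] at hE
    obtain ⟨h1, h2, h3, h4, h5⟩ := hE
    have hJK := eq_zero_of_sum_mul_aeval_pderiv_eq_zero f (Set.range f) 1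
      (fun z hz _ => hJ z fun k => hz _ ⟨k, rfl⟩) (u ∘ Sum.inl) (by simpa using h1) (by simp)
    rw [map_mul, aeval_X, aeval_X, Sum.elim_inl, Sum.elim_inl]
    rcases generic_transversality_field f (u ∘ Sum.inl) _ _ a ha h1 hJK h2 _ h3 h4 _ h5 with h | h
    · have h0 : u (.inr (.inl s)) = 0 := by
        rcases s with s | s
        · exact congrFun h.1 s
        · exact congrFun h.2 s
      rw [h0, zero_mul]
    · have h0 : u (.inr (.inr t)) = 0 := by
        rcases t with t | t
        · exact congrFun h.1 t
        · exact congrFun h.2 t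
      rw [h0, mul_zero]
  choose g hg0 hg using hcase
  refine ⟨∏ s, ∏ t, g s t, Finset.prod_ne_zero_iff.2 fun s _ => Finset.prod_ne_zero_iff.2
    fun t _ => hg0 s t, fun a ha x v η y h1 h2 h3 h4 h5 => ?_⟩
  simp only [map_prod] at ha
  have hE : ∀ e ∈ E, eval (Sum.elim (Sum.elim x (Sum.elim v (Sum.elim y η))) a) e = 0 := by
    have hr : ∀ q, eval (Sum.elim (Sum.elim x (Sum.elim v (Sum.elim y η))) a) (r q) =
        eval x q := fun q => by
      change eval _ (rename _ q) = _
      rw [eval_rename]; rfl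
    simp only [E, Set.mem_union, or_imp, forall_and, Set.forall_mem_range, map_add, map_sum,
      map_mul, hr, V, Y, H, A, eval_X, Sum.elim_inl, Sum.elim_inr]
    exact ⟨h1, h2, h3, h4, h5⟩
  have hz : ∀ s t, v s * (Sum.elim y η) t = 0 := fun s t =>
    hg s t (Sum.elim x (Sum.elim v (Sum.elim y η))) a
      (Finset.prod_ne_zero_iff.1 (Finset.prod_ne_zero_iff.1 ha s (Finset.mem_univ _)) t
        (Finset.mem_univ _)) hE
  by_cases hv : v = 0
  · exact Or.inl hv
  · obtain ⟨s, hs⟩ := Function.ne_iff.1 hv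
    have h0 : ∀ t, (Sum.elim y η) t = 0 := fun t => (mul_eq_zero.1 (hz s t)).resolve_left hs
    exact Or.inr ⟨funext fun k => h0 (.inl k), funext fun k => h0 (.inr k)⟩

theorem Matrix.rank_eq_card_of_forall_vecMul {K κ σ : Type*} [Field K] [Fintype κ] [Fintype σ]
    (A : Matrix κ σ K) (hA : ∀ y, Matrix.vecMul y A = 0 → y = 0) : A.rank = Fintype.card κ := by
  have h : Function.Injective A.vecMulLinear :=
    (injective_iff_map_eq_zero A.vecMulLinear).2 fun y hy => hA y hy
  exact (Matrix.vecMul_injective_iff.1 h).rank_matrix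

theorem Matrix.range_mulVecLin_eq_top_of_forall_vecMul {K κ σ : Type*} [Field K] [Fintype κ]
    [Fintype σ] (A : Matrix κ σ K) (hA : ∀ y, Matrix.vecMul y A = 0 → y = 0) :
    LinearMap.range A.mulVecLin = ⊤ := by
  refine Submodule.eq_top_of_finrank_eq ?_
  rw [Module.finrank_fintype_fun_eq_card, ← A.rank_eq_card_of_forall_vecMul hA, Matrix.rank]

theorem Matrix.finrank_ker_mulVecLin_add_card {K κ σ : Type*} [Field K] [Fintype κ]
    [Fintype σ] (A : Matrix κ σ K) (hA : ∀ y, Matrix.vecMul y A = 0 → y = 0) :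
    Module.finrank K (LinearMap.ker A.mulVecLin) + Fintype.card κ = Fintype.card σ := by
  rw [← A.rank_eq_card_of_forall_vecMul hA, Matrix.rank, add_comm,
    LinearMap.finrank_range_add_finrank_ker, Module.finrank_fintype_fun_eq_card]

theorem MvPolynomial.hasStrictFDerivAt_eval {σ : Type*} [Fintype σ] (f : MvPolynomial σ ℂ)
    (x : σ → ℂ) :
    HasStrictFDerivAt (fun z : σ → ℂ => eval z f)
      (∑ i, eval x (pderiv i f) • ContinuousLinearMap.proj (R := ℂ) (φ := fun _ : σ => ℂ) i) x := by
  classical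
  induction f using MvPolynomial.induction_on with
  | C r =>
    convert! hasStrictFDerivAt_const (𝕜 := ℂ) (F := ℂ) r x using 1
    · simp
    · ext v; simp
  | add f g hf hg =>
    convert! hf.fun_add hg using 1
    · simp
    · ext v; simp [add_mul, Finset.sum_add_distrib]
  | mul_X f j hf =>
    have := hf.fun_mul (hasStrictFDerivAt_apply (𝕜 := ℂ) (F' := fun _ : σ => ℂ) j x)
    convert! this using 1
    · simp
    · ext v
      simp [pderiv_X, Pi.single_apply, apply_ite (eval x), add_mul, Finset.sum_add_distrib,
        Finset.mul_sum, mul_assoc]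

theorem sum_eval_pderiv_mul_eq_zero {σ κ : Type*} [Fintype σ] [Fintype κ]
    (G : κ → MvPolynomial σ ℂ) (q : σ → ℂ) (hq : ∀ k, eval q (G k) = 0)
    (hJ : ∀ y : κ → ℂ, (∀ j, ∑ k, y k * eval q (pderiv j (G k)) = 0) → y = 0)
    (f h : MvPolynomial σ ℂ) (hh : eval q h ≠ 0)
    (hf : ∀ z, (∀ k, eval z (G k) = 0) → eval z h ≠ 0 → eval z f = 0)
    (ξ : σ → ℂ) (hξ : ∀ k, ∑ j, eval q (pderiv j (G k)) * ξ j = 0) :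
    ∑ j, eval q (pderiv j f) * ξ j = 0 := by
  classical
  obtain ⟨G', hG⟩ : ∃ G' : (σ → ℂ) →L[ℂ] (κ → ℂ), G' = ContinuousLinearMap.pi fun k =>
    ∑ i, eval q (pderiv i (G k)) • ContinuousLinearMap.proj (R := ℂ) (φ := fun _ : σ => ℂ) i :=
    ⟨_, rfl⟩
  have hG' : ∀ v k, G' v k = ∑ j, eval q (pderiv j (G k)) * v j := fun v k => by simp [hG]
  have hstrict : HasStrictFDerivAt (fun (z : σ → ℂ) k => eval z (G k)) G' q :=
    hG ▸ hasStrictFDerivAt_pi.2 fun k => hasStrictFDerivAt_eval (G k) q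
  have hsurj : G'.range = ⊤ := by
    let A : Matrix κ σ ℂ := .of fun k j => eval q (pderiv j (G k))
    have hA : (G' : (σ → ℂ) →ₗ[ℂ] κ → ℂ) = A.mulVecLin :=
      LinearMap.ext fun v => funext fun k => hG' v k
    refine (congrArg LinearMap.range hA).trans ?_
    exact A.range_mulVecLin_eq_top_of_forall_vecMul fun y hy => hJ y (congrFun hy)
  have hGξ : G' ξ = 0 := by
    ext k
    rw [hG', hξ, Pi.zero_apply]
  have hmem : ξ ∈ G'.ker := hGξ
  obtain ⟨φ, hφ, hφ0, h1⟩ : ∃ φ : ℂ → σ → ℂ, HasDerivAt φ ξ 0 ∧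
      φ 0 = q ∧ ∀ᶠ t in nhds (0 : ℂ), ∀ k, eval (φ t) (G k) = 0 := by
    let w : G'.ker := ⟨ξ, hmem⟩
    have hw : HasDerivAt (fun t : ℂ => t • w) w 0 := by
      simpa using (hasDerivAt_id (0 : ℂ)).smul_const w
    refine ⟨fun t => hstrict.implicitFunction _ _ hsurj (fun k => eval q (G k)) (t • w), ?_, ?_, ?_⟩
    · have := hstrict.to_implicitFunction hsurj
      rw [← zero_smul ℂ w] at this
      exact this.hasFDerivAt.comp_hasDerivAt (0 : ℂ) hw
    · dsimp only
      rw [zero_smul]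
      exact hstrict.implicitFunction_apply_image hsurj
    · have h2 : Filter.Tendsto (fun t : ℂ => ((fun k => eval q (G k)), t • w)) (nhds 0)
          (nhds ((fun k => eval q (G k)), 0)) := by
        have : Continuous fun t : ℂ => ((fun k => eval q (G k)), t • w) := by fun_prop
        simpa using this.tendsto 0
      filter_upwards [h2.eventually (hstrict.map_implicitFunction_eq hsurj)] with t ht k
      rw [← hq k]
      exact congrFun ht k
  have h2 : ∀ᶠ t in nhds (0 : ℂ), eval (φ t) h ≠ 0 := by
    have hc : ContinuousAt (fun t => eval (φ t) h) 0 :=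
      ContinuousAt.comp (f := φ) (g := fun z => eval z h)
        (hasStrictFDerivAt_eval h _).continuousAt hφ.continuousAt
    exact hc.eventually_ne (by rwa [hφ0])
  have h3 : (fun t => eval (φ t) f) =ᶠ[nhds 0] fun _ => 0 := by
    filter_upwards [h1, h2] with t ht1 ht2 using hf _ ht1 ht2
  have h4 := (hasStrictFDerivAt_eval f (φ 0)).hasFDerivAt.comp_hasDerivAt (0 : ℂ) hφ
  have h5 := h4.unique ((hasDerivAt_const (0 : ℂ) (0 : ℂ)).congr_of_eventuallyEq h3)
  simpa [hφ0] using h5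

theorem ringKrullDim_eq_of_isIntegral {R S : Type*} [CommRing R] [CommRing S] [IsDomain S]
    [Algebra R S] [FaithfulSMul R S] [Algebra.IsIntegral R S] :
    ringKrullDim S = ringKrullDim R := by
  refine le_antisymm ?_ ?_
  · exact Order.krullDim_le_of_strictMono (PrimeSpectrum.comap (algebraMap R S))
      fun I J hIJ => Ideal.IsIntegral.comap_lt_comap hIJ
  · refine iSup_le fun l => ?_
    obtain ⟨Q, -, hQ, hQl⟩ := Ideal.exists_ideal_over_prime_of_isIntegral_of_isPrime
      (S := S) l.head.asIdeal ⊥ (by simp)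
    have : Q.LiesOver l.head.asIdeal := ⟨hQl.symm⟩
    obtain ⟨L, hL, -⟩ := Ideal.exists_ltSeries_of_hasGoingUp l Q
    exact hL ▸ le_iSup (fun L : LTSeries (PrimeSpectrum S) => (L.length : WithBot ℕ∞)) L

theorem derivation_ext_of_surjective {k σ A K : Type*} [CommRing k] [CommRing A] [CommRing K]
    [Algebra k A] [Algebra k K] [Algebra A K] [IsScalarTower k A K] [Algebra.FormallyEtale A K]
    (φ : MvPolynomial σ k →ₐ[k] A) (hφ : Function.Surjective φ) {D D' : Derivation k K K}
    (h : ∀ i, D (algebraMap A K (φ (X i))) = D' (algebraMap A K (φ (X i)))) : D = D' := by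
  refine (existsUnique_derivation_extension k A K (D'.compAlgebraMap A)).unique
    (fun s => ?_) fun s => rfl
  obtain ⟨f, rfl⟩ := hφ s
  change D (algebraMap A K (φ f)) = D' (algebraMap A K (φ f))
  induction f using MvPolynomial.induction_on with
  | C r =>
    rw [← algebraMap_eq, AlgHom.commutes, ← IsScalarTower.algebraMap_apply, D.map_algebraMap,
      D'.map_algebraMap]
  | add f g hf hg => simp only [map_add, hf, hg]
  | mul_X f i hf => simp only [map_mul, Derivation.leibniz, hf, h]

theorem exists_derivation_of_surjective {k σ A K : Type*} [Fintype σ] [CommRing k] [CommRing A]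
    [CommRing K] [Algebra k A] [Algebra k K] [Algebra A K] [IsScalarTower k A K]
    [Algebra.FormallyEtale A K]
    (φ : MvPolynomial σ k →ₐ[k] A) (hφ : Function.Surjective φ) (ξ : σ → K)
    (hξ : ∀ f, φ f = 0 → ∑ j, algebraMap A K (φ (pderiv j f)) * ξ j = 0) :
    ∃ D : Derivation k K K, ∀ i, D (algebraMap A K (φ (X i))) = ξ i := by
  classical
  let d : MvPolynomial σ k →ₗ[k] K :=
    ∑ j, (LinearMap.mulRight k (ξ j)) ∘ₗ (IsScalarTower.toAlgHom k A K).toLinearMap ∘ₗ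
      φ.toLinearMap ∘ₗ (pderiv j).toLinearMap
  have hd : ∀ f, d f = ∑ j, algebraMap A K (φ (pderiv j f)) * ξ j := fun f => by simp [d]
  have hd0 : ∀ f g, φ f = φ g → d f = d g := fun f g h => by
    rw [← sub_eq_zero, ← map_sub, hd, hξ _ (by rw [map_sub, h, sub_self])]
  have hs := Function.surjInv_eq hφ
  have hdS : ∀ f, d (Function.surjInv hφ (φ f)) = d f := fun f => hd0 _ _ (hs _)
  let e₀ : A →ₗ[k] K :=
    { toFun := fun s => d (Function.surjInv hφ s)
      map_add' := fun s t => by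
        rw [← map_add]; exact hd0 _ _ (by rw [map_add, hs, hs, hs])
      map_smul' := fun c s => by
        rw [RingHom.id_apply, ← map_smul]; exact hd0 _ _ (by rw [map_smul, hs, hs]) }
  have he₀ : ∀ f, e₀ (φ f) = d f := hdS
  let e : Derivation k A K := Derivation.mk' e₀ fun s t => by
    obtain ⟨f, rfl⟩ := hφ s
    obtain ⟨g, rfl⟩ := hφ t
    rw [← map_mul, he₀, he₀, he₀, hd, hd, hd, Algebra.smul_def, Algebra.smul_def, Finset.mul_sum,
      Finset.mul_sum, ← Finset.sum_add_distrib]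
    refine Finset.sum_congr rfl fun j _ => ?_
    simp only [Derivation.leibniz, smul_eq_mul, map_add, map_mul]
    ring
  obtain ⟨D, hD, -⟩ := existsUnique_derivation_extension k A K e
  refine ⟨D, fun i => ?_⟩
  rw [hD]
  change e₀ _ = _
  rw [he₀, hd]
  simp [pderiv_X, Pi.single_apply, apply_ite φ]

theorem ringKrullDim_eq_finrank_derivation (k A K : Type*) [Field k] [CharZero k] [CommRing A]
    [IsDomain A] [Algebra k A] [Algebra.FiniteType k A] [Field K] [Algebra A K]
    [IsFractionRing A K] [Algebra k K] [IsScalarTower k A K] :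
    ringKrullDim A = Module.finrank K (Derivation k K K) := by
  obtain ⟨s, g, hg, hgi⟩ := exists_integral_inj_algHom_of_fg k A
  let R := MvPolynomial (Fin s) k
  let _ : Algebra R A := g.toRingHom.toAlgebra
  have : IsScalarTower k R A := .of_algebraMap_eq fun c => (g.commutes c).symm
  have : FaithfulSMul R A := (faithfulSMul_iff_algebraMap_injective R A).2 hg
  have : Algebra.IsIntegral R A := ⟨hgi⟩
  have : Algebra.IsAlgebraic A K := IsLocalization.isAlgebraic K (nonZeroDivisors A)
  have : FaithfulSMul A K := (faithfulSMul_iff_algebraMap_injective A K).2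
    (IsFractionRing.injective A K)
  have : CharZero K := charZero_of_injective_algebraMap (algebraMap k K).injective
  have hx := ((IsTranscendenceBasis.mvPolynomial (Fin s) k).algebraMap_comp
    (A := A)).algebraMap_comp (A := K)
  rw [ringKrullDim_eq_of_isIntegral (R := R), MvPolynomial.ringKrullDim_of_isNoetherianRing,
    ringKrullDim_eq_zero_of_field, zero_add, Nat.card_fin]
  choose D hD hD' using hx.existsUnique_derivation
  let e : (Fin s → K) ≃ₗ[K] Derivation k K K :=
    { toFun := D
      invFun := fun δ i => δ _
      map_add' := fun c d => (hD' _ _ fun i => by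
        simp only [Derivation.add_apply, hD, Pi.add_apply]).symm
      map_smul' := fun c d => (hD' _ _ fun i => by
        simp only [Derivation.smul_apply, hD, Pi.smul_apply, RingHom.id_apply]).symm
      left_inv := fun c => funext (hD c)
      right_inv := fun δ => (hD' _ δ fun i => rfl).symm }
  rw [← e.finrank_eq, Module.finrank_fin_fun]

theorem ringKrullDim_eq_of_jacobian {k A K σ κ : Type*} [Field k] [CharZero k] [CommRing A]
    [IsDomain A] [Algebra k A] [Field K] [Algebra A K] [IsFractionRing A K] [Algebra k K]
    [IsScalarTower k A K] [Fintype σ] [Fintype κ] (φ : MvPolynomial σ k →ₐ[k] A)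
    (hφ : Function.Surjective φ) (x : σ → K) (hx : ∀ f, aeval x f = algebraMap A K (φ f))
    (G : κ → MvPolynomial σ k) (hG : ∀ i, φ (G i) = 0)
    (hJ : ∀ y : κ → K, (∀ j, ∑ i, y i * aeval x (pderiv j (G i)) = 0) → y = 0)
    (hT : ∀ f, φ f = 0 → ∀ ξ : σ → K, (∀ i, ∑ j, aeval x (pderiv j (G i)) * ξ j = 0) →
      ∑ j, aeval x (pderiv j f) * ξ j = 0)
    {d : ℕ} (hd : d + Fintype.card κ = Fintype.card σ) :
    ringKrullDim A = d := by
  have : Algebra.FiniteType k A := .of_surjective φ hφ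
  have : Algebra.FormallyEtale A K := .of_isLocalization (nonZeroDivisors A)
  have hxX : ∀ i, algebraMap A K (φ (X i)) = x i := fun i => by rw [← hx, aeval_X]
  let J : Matrix κ σ K := .of fun i j => aeval x (pderiv j (G i))
  have hJ' := J.finrank_ker_mulVecLin_add_card fun y hy => hJ y fun j => congrFun hy j
  have hker : ∀ ξ, ξ ∈ LinearMap.ker J.mulVecLin ↔
      ∀ i, ∑ j, aeval x (pderiv j (G i)) * ξ j = 0 := fun ξ => funext_iff
  let Φ : Derivation k K K →ₗ[K] LinearMap.ker J.mulVecLin :=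
    { toFun := fun D => ⟨fun i => D (x i), (hker _).2 fun i => by
        have h := D.map_aeval_mvPolynomial x (G i)
        rw [hx, hG, map_zero, map_zero] at h
        exact h.symm⟩
      map_add' := fun D D' => rfl
      map_smul' := fun c D => rfl }
  have hΦ : Function.Bijective Φ := by
    refine ⟨fun D D' h => derivation_ext_of_surjective φ hφ fun i => ?_, fun ξ => ?_⟩
    · rw [hxX]
      exact congrFun (congrArg Subtype.val h) i
    · obtain ⟨D, hD⟩ := exists_derivation_of_surjective (K := K) φ hφ ξ.1 fun f hf => by
        simpa only [hx] using hT f hf ξ.1 ((hker _).1 ξ.2)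
      exact ⟨D, Subtype.ext (funext fun i => by rw [← hD i, hxX]; rfl)⟩
  rw [ringKrullDim_eq_finrank_derivation k A K, (LinearEquiv.ofBijective Φ hΦ).finrank_eq,
    Nat.add_right_cancel (hJ'.trans hd.symm)]

theorem Ideal.exists_notMem_forall_mul_mem_of_mem_minimalPrimes {R : Type*} [CommRing R]
    [IsNoetherianRing R] {I P : Ideal R} (hI : I.IsRadical) (hP : P ∈ I.minimalPrimes) :
    ∃ g ∉ P, ∀ f ∈ P, f * g ∈ I := by
  have hfin := Ideal.finite_minimalPrimes_of_isNoetherianRing R I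
  have hprime : P.IsPrime := hP.1.1
  let s := hfin.toFinset.erase P
  have hs : ¬ s.inf id ≤ P := fun h => by
    obtain ⟨Q, hQ, hQP⟩ := hprime.inf_le'.1 h
    rw [Finset.mem_erase, Set.Finite.mem_toFinset] at hQ
    exact hQ.1 (le_antisymm hQP (hP.2 hQ.2.1 hQP))
  obtain ⟨g, hg, hgP⟩ := SetLike.not_le_iff_exists.1 hs
  refine ⟨g, hgP, fun f hf => ?_⟩
  rw [← hI.radical, ← Ideal.sInf_minimalPrimes, Ideal.mem_sInf]
  intro Q hQ
  by_cases h : Q = P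
  · exact h ▸ P.mul_mem_right g hf
  · exact Q.mul_mem_left f (Finset.inf_le (f := id)
      (Finset.mem_erase.2 ⟨h, hfin.mem_toFinset.2 hQ⟩) hg)

section Jacobian

variable {σ κ ι : Type} [Fintype σ] [Fintype κ] {G : κ → MvPolynomial σ ℂ}
  {h : ι → MvPolynomial σ ℂ} {T : Set (σ → ℂ)}

theorem finrank_tangentAt_eq_of_jacobian [DecidableEq σ]
    (hT : ∀ q, q ∈ T ↔ (∀ k, eval q (G k) = 0) ∧ ∃ s, eval q (h s) ≠ 0)
    (hJ : ∀ q ∈ T, ∀ y : κ → ℂ, (∀ j, ∑ k, y k * eval q (pderiv j (G k)) = 0) → y = 0)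
    {d : ℕ} (hd : d + Fintype.card κ = Fintype.card σ)
    {q : σ → ℂ} (hq : q ∈ T) :
    Module.finrank ℂ (tangentAt T q) = d := by
  let J : Matrix κ σ ℂ := .of fun k j => eval q (pderiv j (G k))
  have hJ' := J.finrank_ker_mulVecLin_add_card fun y hy => hJ q hq y fun j => congrFun hy j
  have hker : tangentAt T q = LinearMap.ker J.mulVecLin := by
    ext ξ
    have h1 : ξ ∈ tangentAt T q ↔
        ∀ f ∈ vanishingIdeal ℂ T, ∑ j, eval q (pderiv j f) * ξ j = 0 := by
      simp [tangentAt]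
    have h2 : ξ ∈ LinearMap.ker J.mulVecLin ↔
      ∀ k, ∑ j, eval q (pderiv j (G k)) * ξ j = 0 := funext_iff
    rw [h1, h2]
    refine ⟨fun hξ k => hξ _ (mem_vanishingIdeal_iff.2 fun z hz => ((hT z).1 hz).1 k),
      fun hξ f hf => ?_⟩
    obtain ⟨hG, s, hs⟩ := (hT q).1 hq
    exact sum_eval_pderiv_mul_eq_zero G q hG (hJ q hq) f (h s) hs
      (fun z hz hzs => mem_vanishingIdeal_iff.1 hf z ((hT z).2 ⟨hz, s, hzs⟩)) ξ hξ
  rw [hker]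
  exact Nat.add_right_cancel (hJ'.trans hd.symm)

theorem isPureDim_of_jacobian
    (hT : ∀ q, q ∈ T ↔ (∀ k, eval q (G k) = 0) ∧ ∃ s, eval q (h s) ≠ 0)
    (hJ : ∀ q ∈ T, ∀ y : κ → ℂ, (∀ j, ∑ k, y k * eval q (pderiv j (G k)) = 0) → y = 0)
    {d : ℕ} (hd : d + Fintype.card κ = Fintype.card σ) :
    IsPureDim T d := by
  intro P hP
  have hrad : (vanishingIdeal ℂ T).IsRadical := fun f ⟨n, hn⟩ =>
    mem_vanishingIdeal_iff.2 fun z hz => eq_zero_of_pow_eq_zero (n := n) (by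
      rw [← map_pow]; exact mem_vanishingIdeal_iff.1 hn z hz)
  obtain ⟨g, hgP, hg⟩ := Ideal.exists_notMem_forall_mul_mem_of_mem_minimalPrimes hrad hP
  have hprime : P.IsPrime := hP.1.1
  obtain ⟨s, hs⟩ : ∃ s, h s ∉ P := by
    by_contra! hs
    refine hgP (hP.1.2 (mem_vanishingIdeal_iff.2 fun z hz => ?_))
    obtain ⟨-, s, hzs⟩ := (hT z).1 hz
    have := mem_vanishingIdeal_iff.1 (hg _ (hs s)) z hz
    rw [map_mul] at this
    exact (mul_eq_zero.1 this).resolve_left hzs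
  let A := MvPolynomial σ ℂ ⧸ P
  let K := FractionRing A
  let φ : MvPolynomial σ ℂ →ₐ[ℂ] A := Ideal.Quotient.mkₐ ℂ P
  let x : σ → K := fun i => algebraMap A K (φ (X i))
  have hx : ∀ f, aeval x f = algebraMap A K (φ f) := fun f => by
    have : aeval x = (IsScalarTower.toAlgHom ℂ A K).comp φ := by ext i; simp [x]
    rw [this]; rfl
  have hφ : ∀ f, φ f = 0 ↔ f ∈ P := fun f => Ideal.Quotient.eq_zero_iff_mem
  have hx0 : ∀ f, aeval x f = 0 ↔ f ∈ P := fun f => by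
    rw [hx, ← hφ, map_eq_zero_iff _ (IsFractionRing.injective A K)]
  have hGP : ∀ k, G k ∈ P := fun k =>
    hP.1.2 (mem_vanishingIdeal_iff.2 fun z hz => ((hT z).1 hz).1 k)
  refine ringKrullDim_eq_of_jacobian φ Ideal.Quotient.mk_surjective x hx G
    (fun k => (hφ _).2 (hGP k)) ?_ ?_ hd
  · refine eq_zero_of_sum_mul_aeval_pderiv_eq_zero G (Set.range G) (h s) (fun z hz hzs => ?_) x
      (Set.forall_mem_range.2 fun k => (hx0 _).2 (hGP k)) fun hs' => hs ((hx0 _).1 hs')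
    exact hJ z ((hT z).2 ⟨fun k => hz _ ⟨k, rfl⟩, s, hzs⟩)
  · intro f hf ξ hξ
    by_contra hne
    let L : MvPolynomial σ ℂ → MvPolynomial (σ ⊕ σ) ℂ := fun f =>
      ∑ j, rename Sum.inl (pderiv j f) * X (Sum.inr j)
    have hL : ∀ f, aeval (Sum.elim x ξ) (L f) = ∑ j, aeval x (pderiv j f) * ξ j := fun f => by
      simp [L, aeval_rename]
    have hLz : ∀ (z : σ ⊕ σ → ℂ) f, eval z (L f) =
        ∑ j, eval (z ∘ Sum.inl) (pderiv j f) * z (Sum.inr j) := fun z f => by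
      simp [L, eval_rename]
    have hne' : aeval (Sum.elim x ξ) (L f * rename Sum.inl (g * h s)) ≠ 0 := by
      rw [map_mul, hL, aeval_rename, Sum.elim_comp_inl, map_mul]
      exact mul_ne_zero hne (mul_ne_zero (mt (hx0 _).1 hgP) (mt (hx0 _).1 hs))
    obtain ⟨z, hz, hz0⟩ := exists_specialization _ hne'
    rw [map_mul, hLz, eval_rename] at hz
    have hzG : ∀ k, eval (z ∘ Sum.inl) (G k) = 0 := fun k => by
      rw [← eval_rename]
      exact hz0 _ (by rw [aeval_rename, Sum.elim_comp_inl]; exact (hx0 _).2 (hGP k))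
    have hzs : eval (z ∘ Sum.inl) (h s) ≠ 0 := fun h0 => right_ne_zero_of_mul hz (by
      rw [map_mul, h0, mul_zero])
    refine left_ne_zero_of_mul hz (sum_eval_pderiv_mul_eq_zero G _ hzG
      (hJ _ ((hT _).2 ⟨hzG, s, hzs⟩)) f (g * h s) (right_ne_zero_of_mul hz) (fun w hw hws => ?_)
      _ fun k => ?_)
    · rw [map_mul] at hws
      have := mem_vanishingIdeal_iff.1 (hg f ((hφ f).1 hf)) w
        ((hT w).2 ⟨hw, s, right_ne_zero_of_mul hws⟩)
      rw [map_mul] at this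
      exact (mul_eq_zero.1 this).resolve_right (left_ne_zero_of_mul hws)
    · rw [← hLz]
      exact hz0 _ (by rw [hL]; exact hξ k)

end Jacobian

section Cone

variable {ι τ μ : Type} [Fintype ι] [Fintype μ]

/-- The equations in the variables `(x, (λ, θ))` of the affine cone of the conormal incidence
variety: `f x = 0` and `J(f)(x)ᵀ·λᵀ + aᵀ·θᵀ = 0`. -/
noncomputable def coneEq (f : ι → MvPolynomial τ ℂ) (a : Matrix μ τ ℂ) :
    ι ⊕ τ → MvPolynomial (τ ⊕ (ι ⊕ μ)) ℂ :=
  Sum.elim (fun k => rename Sum.inl (f k)) fun l =>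
    ∑ k, X (Sum.inr (Sum.inl k)) * rename Sum.inl (pderiv l (f k)) +
      ∑ j, X (Sum.inr (Sum.inr j)) * C (a j l)

/-- The Jacobian matrix of `f` at `x` with the rows of `a` appended. -/
noncomputable def extJac (f : ι → MvPolynomial τ ℂ) (a : Matrix μ τ ℂ) (x : τ → ℂ) :
    Matrix (ι ⊕ μ) τ ℂ :=
  Matrix.fromRows (.of fun k l => eval x (pderiv l (f k))) a

variable (f : ι → MvPolynomial τ ℂ) (a : Matrix μ τ ℂ) (q : τ ⊕ (ι ⊕ μ) → ℂ)

theorem eval_coneEq_inl (k : ι) :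
    eval q (coneEq f a (Sum.inl k)) = eval (q ∘ Sum.inl) (f k) := by
  simp [coneEq, eval_rename]

theorem eval_coneEq_inr (l : τ) :
    eval q (coneEq f a (Sum.inr l)) =
      Matrix.vecMul (q ∘ Sum.inr) (extJac f a (q ∘ Sum.inl)) l := by
  simp [coneEq, eval_rename, extJac, Matrix.vecMul, dotProduct]

theorem pderiv_inr_rename_inl {α β R : Type*} [CommSemiring R] (s : β) (p : MvPolynomial α R) :
    pderiv (Sum.inr s : α ⊕ β) (rename Sum.inl p) = 0 := by
  classical
  refine pderiv_eq_zero_of_notMem_vars fun h => ?_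
  simpa using vars_rename _ _ h

theorem eval_pderiv_coneEq_inl_inl (j : τ) (k : ι) :
    eval q (pderiv (Sum.inl j) (coneEq f a (Sum.inl k))) =
      eval (q ∘ Sum.inl) (pderiv j (f k)) := by
  simp [coneEq, pderiv_rename Sum.inl_injective, eval_rename]

theorem eval_pderiv_coneEq_inr_inl (s : ι ⊕ μ) (k : ι) :
    eval q (pderiv (Sum.inr s) (coneEq f a (Sum.inl k))) = 0 := by
  simp [coneEq, pderiv_inr_rename_inl]

theorem eval_pderiv_coneEq_inl_inr (j l : τ) :
    eval q (pderiv (Sum.inl j) (coneEq f a (Sum.inr l))) =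
      ∑ k, q (Sum.inr (Sum.inl k)) * eval (q ∘ Sum.inl) (pderiv j (pderiv l (f k))) := by
  simp [coneEq, pderiv_rename Sum.inl_injective, eval_rename, Derivation.leibniz]

theorem eval_pderiv_coneEq_inr_inr (s : ι ⊕ μ) (l : τ) :
    eval q (pderiv (Sum.inr s) (coneEq f a (Sum.inr l))) = extJac f a (q ∘ Sum.inl) s l := by
  classical
  rcases s with k | j <;>
  simp [coneEq, pderiv_inr_rename_inl, eval_rename, Derivation.leibniz, extJac, pderiv_X,
    Pi.single_apply]

end Cone

theorem Matrix.exists_mul_mul_eq_one {K α β : Type*} [Field K] [Fintype α] [Fintype β]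
    (M : Matrix α β K) :
    ∃ (A : Matrix (Fin M.rank) α K) (B : Matrix β (Fin M.rank) K), A * M * B = 1 := by
  classical
  let b : Module.Basis (Fin M.rank) K (LinearMap.range M.mulVecLin) :=
    Module.finBasisOfFinrankEq K _ rfl
  choose c hc using fun t => (b t).2
  obtain ⟨g, hg⟩ := (LinearMap.range M.mulVecLin).subtype.exists_leftInverse_of_injective
    (Submodule.ker_subtype _)
  refine ⟨(b.equivFun.toLinearMap ∘ₗ g).toMatrix', Matrix.of fun j t => c t j, ?_⟩
  ext s t
  rw [Matrix.mul_assoc]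
  have h1 : ∀ i, (M * Matrix.of fun j t => c t j) i t = (b t : α → K) i := fun i => by
    rw [← hc]; rfl
  have h2 : ((b.equivFun.toLinearMap ∘ₗ g).toMatrix').mulVec (b t : α → K) = Pi.single t 1 := by
    rw [LinearMap.toMatrix'_mulVec]
    have h3 : g (b t : α → K) = b t := LinearMap.congr_fun hg (b t)
    ext i
    simp [h3, Pi.single_apply, eq_comm]
  have h4 := congrFun h2 s
  rw [Matrix.one_apply, ← Pi.single_apply, ← h4]
  exact Finset.sum_congr rfl fun i _ => congrArg _ (h1 i)

theorem Matrix.card_le_rank_of_det_ne_zero {K α β ρ : Type*} [Field K] [Fintype α] [Fintype β]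
    [Fintype ρ] [DecidableEq ρ] {M : Matrix α β K} {A : Matrix ρ α K} {B : Matrix β ρ K}
    (h : (A * M * B).det ≠ 0) : Fintype.card ρ ≤ (M * B).rank := by
  rw [← Matrix.rank_of_isUnit _ ((Matrix.isUnit_iff_isUnit_det _).2 h.isUnit), Matrix.mul_assoc]
  exact Matrix.rank_mul_le_right _ _

theorem Matrix.det_smul_eq_of_rank_le {K α β ρ : Type*} [Field K] [Fintype α] [Fintype β]
    [Fintype ρ] [DecidableEq ρ] {M : Matrix α β K} {A : Matrix ρ α K} {B : Matrix β ρ K}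
    (h : (A * M * B).det ≠ 0) (hr : M.rank ≤ Fintype.card ρ) :
    (A * M * B).det • M = M * B * (A * M * B).adjugate * (A * M) := by
  classical
  have hle : LinearMap.range (M * B).mulVecLin ≤ LinearMap.range M.mulVecLin := by
    rw [Matrix.mulVecLin_mul]
    exact LinearMap.range_comp_le_range _ _
  have heq := Submodule.eq_of_le_of_finrank_le hle
    (hr.trans (Matrix.card_le_rank_of_det_ne_zero h))
  have hcol : ∀ l, ∃ c, (M * B).mulVec c = M.col l := fun l => by
    have : M.col l ∈ LinearMap.range M.mulVecLin := ⟨Pi.single l 1, by simp⟩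
    rwa [← heq] at this
  choose c hc using hcol
  obtain ⟨C, hC⟩ : ∃ C : Matrix ρ β K, M * B * C = M :=
    ⟨Matrix.of fun t l => c l t, Matrix.ext fun i l => congrFun (hc l) i⟩
  calc (A * M * B).det • M = M * B * ((A * M * B).adjugate * (A * M * B)) * C := by
        rw [Matrix.adjugate_mul, Matrix.mul_smul, Matrix.smul_mul, Matrix.mul_one, hC]
    _ = M * B * (A * M * B).adjugate * (A * (M * B * C)) := by simp only [Matrix.mul_assoc]
    _ = _ := by rw [hC]

theorem exists_eq_smul_of_surjective_of_ker_le {K L T Y : Type*} [Field K] [IsAlgClosed K]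
    [AddCommGroup L] [Module K L] [AddCommGroup T] [Module K T] [AddCommGroup Y] [Module K Y]
    [FiniteDimensional K Y] [Nontrivial Y] (α : L →ₗ[K] T →ₗ[K] Y)
    (hs : ∀ v, v ≠ 0 → Function.Surjective (α v))
    (hk : ∀ v, v ≠ 0 → ∀ u ξ, α v ξ = 0 → α u ξ = 0) {v : L} (hv : v ≠ 0) (u : L) :
    ∃ t : K, t • v = u := by
  obtain ⟨β, hβ⟩ := (α v).exists_rightInverse_of_surjective (LinearMap.range_eq_top.2 (hs v hv))
  obtain ⟨t, ht⟩ := Module.End.exists_eigenvalue (α u ∘ₗ β)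
  obtain ⟨y, hy⟩ := ht.exists_hasEigenvector
  have hvy : α v (β y) = y := LinearMap.congr_fun hβ y
  refine ⟨t, ?_⟩
  by_contra h
  refine hy.2 (hvy ▸ hk (u - t • v) (fun h' => h (sub_eq_zero.1 h').symm) v (β y) ?_)
  have := hy.apply_eq_smul
  rw [LinearMap.comp_apply] at this
  simp [this, hvy]

section Transverse

variable {ι τ μ : Type} [Fintype ι] [Fintype τ] {f : ι → MvPolynomial τ ℂ}
  {a : Matrix μ τ ℂ}

/-- The bilinear map `(v, ξ) ↦ v · dM(ξ)`, where `dM` is the differential at `x` of the Jacobian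
matrix of `f` with constant rows appended. -/
noncomputable def secondVariation (μ : Type) (f : ι → MvPolynomial τ ℂ) (x : τ → ℂ) :
    (ι ⊕ μ → ℂ) →ₗ[ℂ] (τ → ℂ) →ₗ[ℂ] (τ → ℂ) :=
  LinearMap.mk₂ ℂ
    (fun v ξ l => ∑ k, v (Sum.inl k) * ∑ j, eval x (pderiv j (pderiv l (f k))) * ξ j)
    (fun v w ξ => by ext l; simp [add_mul, Finset.sum_add_distrib])
    (fun c v ξ => by ext l; simp [Finset.mul_sum, mul_assoc])
    (fun v ξ ζ => by ext l; simp [mul_add, Finset.sum_add_distrib])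
    (fun c v ξ => by ext l; simp [Finset.mul_sum, mul_left_comm])

theorem secondVariation_apply (x : τ → ℂ) (v : ι ⊕ μ → ℂ) (ξ : τ → ℂ) (l : τ) :
    secondVariation μ f x v ξ l =
      ∑ k, v (Sum.inl k) * ∑ j, eval x (pderiv j (pderiv l (f k))) * ξ j := rfl

variable [Fintype μ]

theorem sum_eval_pderiv_coneEq_inl (q ξ : τ ⊕ (ι ⊕ μ) → ℂ) (k : ι) :
    ∑ s, eval q (pderiv s (coneEq f a (Sum.inl k))) * ξ s =
      ∑ j, eval (q ∘ Sum.inl) (pderiv j (f k)) * ξ (Sum.inl j) := by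
  rw [Fintype.sum_sum_type]
  simp only [eval_pderiv_coneEq_inl_inl, eval_pderiv_coneEq_inr_inl, zero_mul,
    Finset.sum_const_zero, add_zero]

theorem sum_eval_pderiv_coneEq_inr (q ξ : τ ⊕ (ι ⊕ μ) → ℂ) (l : τ) :
    ∑ s, eval q (pderiv s (coneEq f a (Sum.inr l))) * ξ s =
      secondVariation μ f (q ∘ Sum.inl) (q ∘ Sum.inr) (ξ ∘ Sum.inl) l +
        Matrix.vecMul (ξ ∘ Sum.inr) (extJac f a (q ∘ Sum.inl)) l := by
  rw [Fintype.sum_sum_type, secondVariation_apply]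
  simp only [eval_pderiv_coneEq_inl_inr, eval_pderiv_coneEq_inr_inr]
  congr 1
  · simp only [Finset.sum_mul, Finset.mul_sum]
    rw [Finset.sum_comm]
    simp only [mul_assoc, Function.comp_apply]
  · exact Finset.sum_congr rfl fun s _ => mul_comm _ _

/-- The equations of the affine cone of the conormal incidence variety have independent
differentials at all its points. -/
def IsTransverse (f : ι → MvPolynomial τ ℂ) (a : Matrix μ τ ℂ) : Prop :=
  ∀ q : τ ⊕ (ι ⊕ μ) → ℂ, (∀ k, eval q (coneEq f a k) = 0) → q ∘ Sum.inr ≠ 0 →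
    ∀ y : ι ⊕ τ → ℂ, (∀ s, ∑ k, y k * eval q (pderiv s (coneEq f a k)) = 0) → y = 0

theorem exists_forall_isTransverse (μ : Type) [Fintype μ] (f : ι → MvPolynomial τ ℂ)
    (hJ : ∀ z, (∀ k, eval z (f k) = 0) →
      ∀ y : ι → ℂ, (∀ l, ∑ k, y k * eval z (pderiv l (f k)) = 0) → y = 0) :
    ∃ g : MvPolynomial (μ × τ) ℂ, g ≠ 0 ∧ ∀ a : Matrix μ τ ℂ,
      eval (fun s => a s.1 s.2) g ≠ 0 → IsTransverse f a := by
  obtain ⟨g, hg, H⟩ := exists_generic_transversality (μ := μ) f hJ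
  refine ⟨g, hg, fun a ha q hq hv y hy => ?_⟩
  rw [Sum.forall] at hq hy
  have key := H _ ha (q ∘ Sum.inl) (q ∘ Sum.inr) (y ∘ Sum.inr) (y ∘ Sum.inl)
    (fun k => by rw [← eval_coneEq_inl f a]; exact hq.1 k)
    (fun l => by
      rw [← hq.2 l, eval_coneEq_inr]
      simp [extJac, Matrix.vecMul, dotProduct])
    (fun k => by
      rw [← hy.2 (Sum.inl k)]
      simp [eval_pderiv_coneEq_inr_inl, eval_pderiv_coneEq_inr_inr, extJac, mul_comm])
    (fun j => by
      rw [← hy.2 (Sum.inr j)]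
      simp [eval_pderiv_coneEq_inr_inl, eval_pderiv_coneEq_inr_inr, extJac, mul_comm])
    (fun j => by
      rw [← hy.1 j]
      simp only [Fintype.sum_sum_type, eval_pderiv_coneEq_inl_inl, eval_pderiv_coneEq_inl_inr,
        Function.comp_apply, Finset.mul_sum]
      rw [Finset.sum_comm (s := Finset.univ (α := τ))]
      simp only [mul_comm])
  obtain ⟨h1, h2⟩ := key.resolve_left hv
  ext (k | l)
  exacts [congrFun h1 k, congrFun h2 l]

theorem IsTransverse.exists_secondVariation_add_vecMul_eq (h : IsTransverse f a) {x : τ → ℂ}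
    (hx : ∀ k, eval x (f k) = 0) {v : ι ⊕ μ → ℂ} (hv : v ≠ 0)
    (hvx : Matrix.vecMul v (extJac f a x) = 0) (y : τ → ℂ) :
    ∃ ξ : τ → ℂ, (∀ k, ∑ j, eval x (pderiv j (f k)) * ξ j = 0) ∧
      ∃ c, secondVariation μ f x v ξ + Matrix.vecMul c (extJac f a x) = y := by
  let q : τ ⊕ (ι ⊕ μ) → ℂ := Sum.elim x v
  let J : Matrix (ι ⊕ τ) (τ ⊕ (ι ⊕ μ)) ℂ := .of fun k s => eval q (pderiv s (coneEq f a k))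
  have hq : ∀ k, eval q (coneEq f a k) = 0 := by
    rw [Sum.forall]
    exact ⟨fun k => (eval_coneEq_inl f a q k).trans (hx k),
      fun l => (eval_coneEq_inr f a q l).trans (congrFun hvx l)⟩
  have hJ := J.range_mulVecLin_eq_top_of_forall_vecMul fun y hy => h q hq hv y fun j =>
    congrFun hy j
  obtain ⟨ξ, hξ⟩ := LinearMap.range_eq_top.1 hJ (Sum.elim 0 y)
  refine ⟨ξ ∘ Sum.inl, fun k => ?_, ξ ∘ Sum.inr, funext fun l => ?_⟩
  · exact (sum_eval_pderiv_coneEq_inl (a := a) q ξ k).symm.trans (congrFun hξ (Sum.inl k))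
  · exact (sum_eval_pderiv_coneEq_inr q ξ l).symm.trans (congrFun hξ (Sum.inr l))

theorem IsTransverse.exists_secondVariation_eq_vecMul (h : IsTransverse f a) {x : τ → ℂ}
    (hx : ∀ k, eval x (f k) = 0) {φ : MvPolynomial τ ℂ} (hφ : eval x φ ≠ 0)
    (hmax : ∀ z, (∀ k, eval z (f k) = 0) → eval z φ ≠ 0 →
      (∃ v ≠ 0, Matrix.vecMul v (extJac f a z) = 0) → (extJac f a z).rank ≤ (extJac f a x).rank)
    {v u : ι ⊕ μ → ℂ} (hv : v ≠ 0) (hvx : Matrix.vecMul v (extJac f a x) = 0)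
    (hux : Matrix.vecMul u (extJac f a x) = 0) {ξ : τ → ℂ}
    (hξ : ∀ k, ∑ j, eval x (pderiv j (f k)) * ξ j = 0)
    (hvξ : ∃ c, Matrix.vecMul c (extJac f a x) = secondVariation μ f x v ξ) :
    ∃ c, Matrix.vecMul c (extJac f a x) = secondVariation μ f x u ξ := by
  classical
  obtain ⟨A, B, hAB⟩ := (extJac f a x).exists_mul_mul_eq_one
  let M : Matrix (ι ⊕ μ) τ (MvPolynomial τ ℂ) :=
    Matrix.fromRows (.of fun k l => pderiv l (f k)) (a.map C)
  have hM : ∀ z, M.map (eval z) = extJac f a z := fun z => by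
    ext (k | j) l <;> simp [M, extJac]
  let A' : Matrix (Fin (extJac f a x).rank) (ι ⊕ μ) (MvPolynomial τ ℂ) := A.map C
  let B' : Matrix τ (Fin (extJac f a x).rank) (MvPolynomial τ ℂ) := B.map C
  have hA : ∀ z, A'.map (eval z) = A := fun z => by ext; simp [A']
  have hB : ∀ z, B'.map (eval z) = B := fun z => by ext; simp [B']
  let Δ := A' * M * B'
  have hΔ : ∀ z, Δ.map (eval z) = A * extJac f a z * B := fun z => by
    rw [Matrix.map_mul, Matrix.map_mul, hA, hB, hM]
  have hdet : ∀ z, eval z Δ.det = (A * extJac f a z * B).det := fun z => by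
    rw [RingHom.map_det, RingHom.mapMatrix_apply, hΔ]
  have hadj : ∀ z, Δ.adjugate.map (eval z) = (A * extJac f a z * B).adjugate := fun z => by
    rw [← RingHom.mapMatrix_apply, RingHom.map_adjugate, RingHom.mapMatrix_apply, hΔ]
  let N : τ → MvPolynomial τ ℂ := fun l => ∑ s, C (u s) * M s l
  have hN : ∀ z l, eval z (N l) = Matrix.vecMul u (extJac f a z) l := fun z l => by
    simp [N, ← hM z, Matrix.vecMul, dotProduct]
  let W : Matrix τ τ (MvPolynomial τ ℂ) := Δ.det • 1 - B' * Δ.adjugate * (A' * M)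
  have hW : ∀ z, W.map (eval z) = (A * extJac f a z * B).det • 1 -
      B * (A * extJac f a z * B).adjugate * (A * extJac f a z) := fun z => by
    rw [Matrix.map_sub _ (map_sub _), Matrix.map_mul, Matrix.map_mul, Matrix.map_mul, hA, hB, hM,
      hadj, ← hdet]
    congr 1
    ext i j
    by_cases hij : i = j <;> simp [hij]
  have hW' : ∀ z i l, eval z (W i l) = W.map (eval z) i l := fun z i l => rfl
  obtain ⟨s, hs⟩ := Function.ne_iff.1 hv
  obtain ⟨c, hc⟩ := hvξ
  let q : τ ⊕ (ι ⊕ μ) → ℂ := Sum.elim x v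
  have hq : ∀ k, eval q (coneEq f a k) = 0 := by
    rw [Sum.forall]
    exact ⟨fun k => (eval_coneEq_inl f a q k).trans (hx k),
      fun l => (eval_coneEq_inr f a q l).trans (congrFun hvx l)⟩
  have hN0 : ∀ l, eval x (N l) = 0 := fun l => by rw [hN, hux, Pi.zero_apply]
  have hg : ∀ l, ∑ j, eval x (pderiv j (∑ i, N i * W i l)) * ξ j = 0 := fun l => by
    have := sum_eval_pderiv_mul_eq_zero (coneEq f a) q hq (h q hq hv)
      (rename Sum.inl (∑ i, N i * W i l)) (rename Sum.inl (φ * Δ.det) * X (Sum.inr s))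
      ?_ ?_ (Sum.elim ξ (-c)) ?_
    · rw [Fintype.sum_sum_type] at this
      simpa [pderiv_inr_rename_inl, pderiv_rename Sum.inl_injective, eval_rename, q] using this
    · rw [map_mul, eval_rename, eval_X, map_mul]
      refine mul_ne_zero (mul_ne_zero hφ ?_) hs
      change eval x Δ.det ≠ 0
      rw [hdet, hAB, Matrix.det_one]
      exact one_ne_zero
    · intro z hz hzh
      rw [Sum.forall] at hz
      rw [map_mul, eval_rename, eval_X, map_mul, hdet] at hzh
      rw [eval_rename]
      have hr := hmax (z ∘ Sum.inl) (fun k => by rw [← hz.1 k, eval_coneEq_inl])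
        (left_ne_zero_of_mul (left_ne_zero_of_mul hzh))
        ⟨z ∘ Sum.inr, fun h0 => right_ne_zero_of_mul hzh (congrFun h0 s),
          funext fun l => by rw [← eval_coneEq_inr, hz.2, Pi.zero_apply]⟩
      have hdz := Matrix.det_smul_eq_of_rank_le
        (right_ne_zero_of_mul (left_ne_zero_of_mul hzh)) (hr.trans (Fintype.card_fin _).ge)
      simp only [map_sum, map_mul, hN, hW']
      change Matrix.vecMul (Matrix.vecMul u _) (W.map (eval (z ∘ Sum.inl))) l = 0
      rw [Matrix.vecMul_vecMul, hW, Matrix.mul_sub, Matrix.mul_smul, Matrix.mul_one, hdz]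
      simp only [Matrix.mul_assoc, sub_self, Matrix.vecMul_zero, Pi.zero_apply]
    · rw [Sum.forall]
      refine ⟨fun k => ?_, fun l => ?_⟩
      · rw [sum_eval_pderiv_coneEq_inl]
        exact hξ k
      · rw [sum_eval_pderiv_coneEq_inr]
        change secondVariation μ f x v ξ l + Matrix.vecMul (-c) (extJac f a x) l = 0
        rw [Matrix.neg_vecMul, hc, Pi.neg_apply, add_neg_cancel]
  have hdN : ∀ l, ∑ j, eval x (pderiv j (N l)) * ξ j = secondVariation μ f x u ξ l := fun l => by
    rw [secondVariation_apply]
    have : ∀ j, eval x (pderiv j (N l)) =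
        ∑ k, u (Sum.inl k) * eval x (pderiv j (pderiv l (f k))) := fun j => by
      simp [N, M, Derivation.leibniz]
    simp only [this, Finset.sum_mul, Finset.mul_sum, mul_assoc]
    exact Finset.sum_comm
  refine ⟨Matrix.vecMul (Matrix.vecMul (secondVariation μ f x u ξ) B) A, funext fun l => ?_⟩
  have hgl := hg l
  have : ∀ j, eval x (pderiv j (∑ i, N i * W i l)) * ξ j =
      ∑ i, eval x (pderiv j (N i)) * ξ j * W.map (eval x) i l := fun j => by
    simp only [map_sum, Derivation.leibniz, map_add, smul_eq_mul, map_mul, hN0, zero_mul, zero_add,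
      Finset.sum_mul, hW']
    exact Finset.sum_congr rfl fun i _ => by ring
  simp only [this] at hgl
  rw [Finset.sum_comm] at hgl
  simp only [← Finset.sum_mul, hdN] at hgl
  change Matrix.vecMul _ (W.map (eval x)) l = 0 at hgl
  rw [hW, hAB, Matrix.det_one, one_smul, Matrix.adjugate_one, Matrix.mul_one, Matrix.vecMul_sub,
    Matrix.vecMul_one, Pi.sub_apply, sub_eq_zero] at hgl
  rw [hgl]
  simp only [Matrix.vecMul_vecMul, Matrix.mul_assoc]

theorem IsTransverse.exists_smul_eq (h : IsTransverse f a)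
    (hcard : Fintype.card (ι ⊕ μ) ≤ Fintype.card τ) {x : τ → ℂ}
    (hx : ∀ k, eval x (f k) = 0) {φ : MvPolynomial τ ℂ} (hφ : eval x φ ≠ 0)
    (hmax : ∀ z, (∀ k, eval z (f k) = 0) → eval z φ ≠ 0 →
      (∃ v ≠ 0, Matrix.vecMul v (extJac f a z) = 0) → (extJac f a z).rank ≤ (extJac f a x).rank)
    {v u : ι ⊕ μ → ℂ} (hv : v ≠ 0) (hvx : Matrix.vecMul v (extJac f a x) = 0)
    (hux : Matrix.vecMul u (extJac f a x) = 0) : ∃ t : ℂ, t • v = u := by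
  let M := extJac f a x
  let J : Matrix ι τ ℂ := .of fun k j => eval x (pderiv j (f k))
  let L := LinearMap.ker M.vecMulLinear
  let T := LinearMap.ker J.mulVecLin
  let R := LinearMap.range M.vecMulLinear
  have hT : ∀ ξ, ξ ∈ T ↔ ∀ k, ∑ j, eval x (pderiv j (f k)) * ξ j = 0 := fun ξ => funext_iff
  let α : L →ₗ[ℂ] T →ₗ[ℂ] ((τ → ℂ) ⧸ R) :=
    ((secondVariation μ f x).compr₂ R.mkQ).domRestrict₁₂ L T
  have hα : ∀ (v : L) (ξ : T), α v ξ = R.mkQ (secondVariation μ f x v ξ) := fun v ξ => rfl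
  have hR : Nontrivial ((τ → ℂ) ⧸ R) := by
    refine Submodule.Quotient.nontrivial_iff.2 fun htop => hv ?_
    have h1 := LinearMap.finrank_range_add_finrank_ker M.vecMulLinear
    rw [show LinearMap.range M.vecMulLinear = ⊤ from htop, finrank_top, Module.finrank_pi,
      Module.finrank_pi] at h1
    have h2 : Module.finrank ℂ L = 0 := by
      change Module.finrank ℂ (LinearMap.ker M.vecMulLinear) = 0
      omega
    have h3 : v ∈ L := hvx
    rwa [Submodule.finrank_eq_zero.1 h2] at h3
  suffices H : ∃ t : ℂ, t • (⟨v, hvx⟩ : L) = ⟨u, hux⟩ by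
    obtain ⟨t, ht⟩ := H
    exact ⟨t, congrArg Subtype.val ht⟩
  refine exists_eq_smul_of_surjective_of_ker_le α ?_ ?_
    (fun h0 => hv (congrArg Subtype.val h0)) ⟨u, hux⟩
  · intro v hv y
    obtain ⟨y, rfl⟩ := R.mkQ_surjective y
    obtain ⟨ξ, hξ, c, hc⟩ := h.exists_secondVariation_add_vecMul_eq hx
      (fun h0 => hv (Subtype.ext h0)) v.2 y
    refine ⟨⟨ξ, (hT ξ).2 hξ⟩, ?_⟩
    rw [hα, ← hc, map_add]
    exact (add_eq_left.2 ((Submodule.Quotient.mk_eq_zero R).2 ⟨c, rfl⟩)).symm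
  · intro v hv u ξ hvξ
    rw [hα] at hvξ ⊢
    exact (Submodule.Quotient.mk_eq_zero R).2 (h.exists_secondVariation_eq_vecMul hx hφ hmax
      (fun h0 => hv (Subtype.ext h0)) v.2 u.2 ((hT _).1 ξ.2)
      ((Submodule.Quotient.mk_eq_zero R).1 hvξ))

end Transverse

theorem Matrix.finrank_ker_vecMulLinear_add_rank {K α β : Type*} [Field K] [Fintype α] [Fintype β]
    (M : Matrix α β K) :
    Module.finrank K (LinearMap.ker M.vecMulLinear) + M.rank = Fintype.card α := by
  rw [← Matrix.rank_transpose, Matrix.rank, Matrix.mulVecLin_transpose, add_comm,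
    LinearMap.finrank_range_add_finrank_ker, Module.finrank_pi]

theorem Matrix.exists_vecMul_eq_zero_iff_rank_lt {K α β : Type*} [Field K] [Fintype α] [Fintype β]
    (M : Matrix α β K) : (∃ v ≠ 0, Matrix.vecMul v M = 0) ↔ M.rank < Fintype.card α := by
  have h := M.finrank_ker_vecMulLinear_add_rank
  have h1 : (∃ v ≠ 0, Matrix.vecMul v M = 0) ↔ LinearMap.ker M.vecMulLinear ≠ ⊥ := by
    rw [Submodule.ne_bot_iff]
    exact ⟨fun ⟨v, h1, h2⟩ => ⟨v, h2, h1⟩, fun ⟨v, h1, h2⟩ => ⟨v, h2, h1⟩⟩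
  rw [h1, ne_eq, ← Submodule.finrank_eq_zero]
  omega

theorem Matrix.exists_smul_eq_of_card_le_rank_add_one {K α β : Type*} [Field K] [Fintype α]
    [Fintype β] {M : Matrix α β K} (hM : Fintype.card α ≤ M.rank + 1) {v u : α → K} (hv : v ≠ 0)
    (hvM : Matrix.vecMul v M = 0) (huM : Matrix.vecMul u M = 0) : ∃ t : K, t • v = u := by
  have h := M.finrank_ker_vecMulLinear_add_rank
  have h0 : (⟨v, hvM⟩ : LinearMap.ker M.vecMulLinear) ≠ 0 := fun h0 =>
    hv (congrArg Subtype.val h0)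
  have h1 : Module.finrank K (LinearMap.ker M.vecMulLinear) = 1 :=
    le_antisymm (by omega) (Module.finrank_pos_iff_exists_ne_zero.2 ⟨_, h0⟩)
  obtain ⟨t, ht⟩ := exists_smul_eq_of_finrank_eq_one h1 h0 ⟨u, huM⟩
  exact ⟨t, congrArg Subtype.val ht⟩

theorem Matrix.card_le_rank_add_one {K α β : Type*} [Field K] [Fintype α]
    [Fintype β] {M : Matrix α β K} {v : α → K}
    (hM : ∀ u, Matrix.vecMul u M = 0 → ∃ t : K, t • v = u) : Fintype.card α ≤ M.rank + 1 := by
  have h := M.finrank_ker_vecMulLinear_add_rank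
  have hle : LinearMap.ker M.vecMulLinear ≤ Submodule.span K {v} := fun u hu =>
    Submodule.mem_span_singleton.2 (hM u hu)
  have := (Submodule.finrank_mono hle).trans (finrank_span_le_card ({v} : Set (α → K)))
  simp at this
  omega

section ZariskiClosure

variable {σ : Type}

theorem subset_zcl (S : Set (σ → ℂ)) : S ⊆ zcl S := fun x hx =>
  mem_zeroLocus_iff.2 fun _ hp => mem_vanishingIdeal_iff.1 hp x hx

theorem zcl_subset_zcl {S T : Set (σ → ℂ)} (h : S ⊆ zcl T) : zcl S ⊆ zcl T := fun _ hx =>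
  mem_zeroLocus_iff.2 fun p hp => mem_zeroLocus_iff.1 hx p
    (mem_vanishingIdeal_iff.2 fun _ hz => mem_zeroLocus_iff.1 (h hz) p hp)

theorem zcl_empty : zcl (∅ : Set (σ → ℂ)) = ∅ := by
  rw [zcl, vanishingIdeal_empty]
  exact Set.eq_empty_of_forall_notMem fun x hx => by
    simpa using mem_zeroLocus_iff.1 hx 1 trivial

theorem zOpen_compl_zcl (S : Set (σ → ℂ)) : ZOpen (zcl S)ᶜ := by
  refine ⟨vanishingIdeal ℂ S, Set.ext fun x => ?_⟩
  rw [Set.mem_compl_iff, zcl, mem_zeroLocus_iff]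
  push Not
  rfl

theorem ZOpenMat.exists_inter_ne_zero {m n : ℕ} {U : Set (Matrix (Fin m) (Fin n) ℂ)}
    (hU : ZOpenMat U) (hne : U.Nonempty) {g : MvPolynomial (Fin m × Fin n) ℂ} (hg : g ≠ 0) :
    ZOpenMat (U ∩ {a | eval (fun q => a q.1 q.2) g ≠ 0}) ∧
      (U ∩ {a | eval (fun q => a q.1 q.2) g ≠ 0}).Nonempty := by
  obtain ⟨I, rfl⟩ := hU
  refine ⟨⟨I * Ideal.span {g}, Set.ext fun a => ?_⟩, ?_⟩
  · constructor
    · rintro ⟨⟨f, hf, hfa⟩, hga⟩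
      exact ⟨f * g, Ideal.mul_mem_mul hf (Ideal.mem_span_singleton_self g), by
        rw [map_mul]; exact mul_ne_zero hfa hga⟩
    · rintro ⟨f, hf, hfa⟩
      obtain ⟨f', hf', rfl⟩ := Ideal.mem_mul_span_singleton.1 hf
      rw [map_mul] at hfa
      exact ⟨⟨f', hf', left_ne_zero_of_mul hfa⟩, right_ne_zero_of_mul hfa⟩
  · obtain ⟨a, f, hf, hfa⟩ := hne
    have hf0 : f ≠ 0 := fun h => hfa (by rw [h, map_zero])
    obtain ⟨z, hz⟩ : ∃ z, eval z (f * g) ≠ 0 := by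
      by_contra! h
      exact mul_ne_zero hf0 hg (MvPolynomial.funext fun z => by rw [h, map_zero])
    rw [map_mul] at hz
    exact ⟨Matrix.of fun j l => z (j, l), ⟨f, hf, left_ne_zero_of_mul hz⟩,
      right_ne_zero_of_mul hz⟩

end ZariskiClosure

section PolarLocus

variable {ι τ μ : Type} [Fintype ι] [Fintype τ] [Fintype μ] {f : ι → MvPolynomial τ ℂ}
  {a : Matrix μ τ ℂ}

/-- The points of `{f = 0}` at which the Jacobian matrix of `f` with the rows of `a` appended has
linearly dependent rows. -/
def polarLocus (f : ι → MvPolynomial τ ℂ) (a : Matrix μ τ ℂ) : Set (τ → ℂ) :=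
  {x | (∀ k, eval x (f k) = 0) ∧ ∃ v ≠ 0, Matrix.vecMul v (extJac f a x) = 0}

theorem exists_eval_eq_det_extJac {ρ : Type*} [Fintype ρ] [DecidableEq ρ]
    (f : ι → MvPolynomial τ ℂ) (a : Matrix μ τ ℂ) (A : Matrix ρ (ι ⊕ μ) ℂ) (B : Matrix τ ρ ℂ) :
    ∃ D : MvPolynomial τ ℂ, ∀ z, eval z D = (A * extJac f a z * B).det := by
  let M : Matrix (ι ⊕ μ) τ (MvPolynomial τ ℂ) :=
    Matrix.fromRows (.of fun k l => pderiv l (f k)) (a.map C)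
  let A' : Matrix ρ (ι ⊕ μ) (MvPolynomial τ ℂ) := A.map C
  let B' : Matrix τ ρ (MvPolynomial τ ℂ) := B.map C
  refine ⟨(A' * M * B').det, fun z => ?_⟩
  have hA : A'.map (eval z) = A := by ext; simp [A']
  have hB : B'.map (eval z) = B := by ext; simp [B']
  have hM : M.map (eval z) = extJac f a z := by ext (k | j) l <;> simp [M, extJac]
  rw [RingHom.map_det, RingHom.mapMatrix_apply, Matrix.map_mul, Matrix.map_mul, hA, hB, hM]

theorem rank_extJac_le_of_mem_zcl {S : Set (τ → ℂ)} {r : ℕ}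
    (hS : ∀ x ∈ S, (extJac f a x).rank ≤ r) {x : τ → ℂ} (hx : x ∈ zcl S) :
    (extJac f a x).rank ≤ r := by
  obtain ⟨A, B, hAB⟩ := (extJac f a x).exists_mul_mul_eq_one
  obtain ⟨D, hD⟩ := exists_eval_eq_det_extJac f a A B
  have hDx : eval x D ≠ 0 := by rw [hD, hAB, Matrix.det_one]; exact one_ne_zero
  by_contra! hr
  refine hDx (mem_zeroLocus_iff.1 hx D (mem_vanishingIdeal_iff.2 fun z hz => ?_))
  change eval z D = 0
  rw [hD]
  by_contra hne
  have := (Matrix.card_le_rank_of_det_ne_zero hne).trans (Matrix.rank_mul_le_left _ _)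
  rw [Fintype.card_fin] at this
  exact absurd (hS z hz) (by omega)

theorem zcl_polarLocus_inter :
    zcl (polarLocus f a) ∩ {x | ∀ k, eval x (f k) = 0} = polarLocus f a := by
  refine Set.Subset.antisymm (fun x hx => ⟨hx.2, ?_⟩) fun x hx => ⟨subset_zcl _ hx, hx.1⟩
  rw [Matrix.exists_vecMul_eq_zero_iff_rank_lt]
  have hS : ∀ z ∈ polarLocus f a, (extJac f a z).rank < Fintype.card (ι ⊕ μ) := fun z hz =>
    (Matrix.exists_vecMul_eq_zero_iff_rank_lt _).1 hz.2
  by_cases hne : (polarLocus f a).Nonempty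
  · obtain ⟨z, hz⟩ := hne
    have h0 := hS z hz
    have := rank_extJac_le_of_mem_zcl (fun z hz => Nat.le_sub_one_of_lt (hS z hz)) hx.1
    omega
  · rw [Set.not_nonempty_iff_eq_empty.1 hne, zcl_empty] at hx
    exact hx.1.elim

theorem IsTransverse.exists_zOpen (h : IsTransverse f a)
    (hcard : Fintype.card (ι ⊕ μ) ≤ Fintype.card τ) :
    ∃ Z : Set (τ → ℂ), ZOpen Z ∧ zcl (zcl (polarLocus f a) ∩ Z) = zcl (polarLocus f a) ∧
      ∀ x ∈ Z, Fintype.card (ι ⊕ μ) ≤ (extJac f a x).rank + 1 := by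
  let S : Set (τ → ℂ) := {x | (extJac f a x).rank + 1 < Fintype.card (ι ⊕ μ)}
  refine ⟨(zcl S)ᶜ, zOpen_compl_zcl S, ?_, fun x hx => not_lt.1 fun hlt => hx (subset_zcl S hlt)⟩
  refine Set.Subset.antisymm (zcl_subset_zcl Set.inter_subset_left)
    (zcl_subset_zcl fun x hx => mem_zeroLocus_iff.2 fun φ hφ => ?_)
  by_contra hφx
  let r : (τ → ℂ) → ℕ := fun z => (extJac f a z).rank
  let Λ : Set (τ → ℂ) := {z | z ∈ polarLocus f a ∧ eval z φ ≠ 0}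
  have hbdd : BddAbove (r '' Λ) := ⟨Fintype.card (ι ⊕ μ), by
    rintro _ ⟨z, -, rfl⟩
    exact Matrix.rank_le_card_height _⟩
  obtain ⟨z, hz, hzr⟩ := Nat.sSup_mem (Set.Nonempty.image r (s := Λ) ⟨x, hx, hφx⟩) hbdd
  obtain ⟨v, hv, hvz⟩ := hz.1.2
  have hmax : Fintype.card (ι ⊕ μ) ≤ (extJac f a z).rank + 1 :=
    Matrix.card_le_rank_add_one fun u hu => h.exists_smul_eq hcard hz.1.1 hz.2
      (fun w hw hwφ hwv => (le_csSup hbdd ⟨w, ⟨⟨hw, hwv⟩, hwφ⟩, rfl⟩).trans hzr.ge) hv hvz hu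
  refine hz.2 (mem_vanishingIdeal_iff.1 hφ z ⟨subset_zcl _ hz.1, fun hzS => ?_⟩)
  have := rank_extJac_le_of_mem_zcl (f := f) (a := a) (r := Fintype.card (ι ⊕ μ) - 2)
    (fun w hw => by
      have hw' : (extJac f a w).rank + 1 < Fintype.card (ι ⊕ μ) := hw
      omega) hzS
  by_cases hS : S.Nonempty
  · obtain ⟨w, hw⟩ := hS
    have hw' : (extJac f a w).rank + 1 < Fintype.card (ι ⊕ μ) := hw
    omega
  · rw [Set.not_nonempty_iff_eq_empty.1 hS, zcl_empty] at hzS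
    exact hzS

end PolarLocus

section Rational

variable {n p m : ℕ} {F : Fin p → MvPolynomial (Fin n) ℚ} {a : Matrix (Fin m) (Fin n) ℂ}

/-- The polynomials `F` with coefficients extended to `ℂ`. -/
noncomputable def complexify (F : Fin p → MvPolynomial (Fin n) ℚ) (k : Fin p) :
    MvPolynomial (Fin n) ℂ :=
  map (algebraMap ℚ ℂ) (F k)

theorem mem_zeroSetC_iff {x : Fin n → ℂ} :
    x ∈ zeroSetC F ↔ ∀ k, eval x (complexify F k) = 0 :=
  forall_congr' fun k => by rw [complexify, eval_map, aeval_def]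

theorem jacC_apply (x : Fin n → ℂ) (k : Fin p) (l : Fin n) :
    jacC F x k l = eval x (pderiv l (complexify F k)) := by
  rw [complexify, pderiv_map, eval_map]
  exact aeval_def _ _

theorem fromRows_jacC (x : Fin n → ℂ) :
    Matrix.fromRows (jacC F x) a = extJac (complexify F) a x := by
  ext (k | j) l
  · exact jacC_apply x k l
  · rfl

theorem eq_zero_of_mem_SregC {x : Fin n → ℂ} (hx : x ∈ SregC F) {y : Fin p → ℂ}
    (hy : ∀ l, ∑ k, y k * eval x (pderiv l (complexify F k)) = 0) : y = 0 := by
  by_contra hy0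
  have := (Matrix.exists_vecMul_eq_zero_iff_rank_lt (jacC F x)).1 ⟨y, hy0, funext fun l => by
    simpa only [Matrix.vecMul, dotProduct, jacC_apply, Pi.zero_apply] using hy l⟩
  rw [hx.2, Fintype.card_fin] at this
  exact this.false

theorem Wclassic_eq_zcl_polarLocus (hsmooth : SregC F = zeroSetC F) {r : ℕ}
    (hr : r + 1 = p + m) : Wclassic F a r = zcl (polarLocus (complexify F) a) := by
  refine congrArg zcl (Set.ext fun x => ?_)
  rw [Set.mem_ofPred_eq, hsmooth, mem_zeroSetC_iff, fromRows_jacC, polarLocus, Set.mem_ofPred_eq,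
    Matrix.exists_vecMul_eq_zero_iff_rank_lt, Fintype.card_sum, Fintype.card_fin,
    Fintype.card_fin, ← hr, Nat.lt_succ_iff]

theorem mem_HconeA_iff (hsmooth : SregC F = zeroSetC F) {q : Fin n ⊕ (Fin p ⊕ Fin m) → ℂ} :
    q ∈ HconeA F a ↔ (∀ k, eval q (coneEq (complexify F) a k) = 0) ∧ q ∘ Sum.inr ≠ 0 := by
  rw [Sum.forall]
  simp only [eval_coneEq_inl, eval_coneEq_inr]
  rw [← mem_zeroSetC_iff, ← hsmooth, and_assoc, and_comm (b := q ∘ Sum.inr ≠ 0), HconeA,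
    Set.mem_ofPred_eq, fromRows_jacC]
  exact and_congr_right' (and_congr_right' funext_iff)

theorem image_HconeA (hsmooth : SregC F = zeroSetC F) :
    (fun q (l : Fin n) => q (Sum.inl l)) '' HconeA F a = polarLocus (complexify F) a := by
  ext x
  constructor
  · rintro ⟨q, ⟨hq, hv, hvq⟩, rfl⟩
    exact ⟨mem_zeroSetC_iff.1 hq.1, _, hv, by rwa [← fromRows_jacC]⟩
  · rintro ⟨hx, v, hv, hvx⟩
    refine ⟨Sum.elim x v, ⟨?_, hv, ?_⟩, rfl⟩
    · rw [hsmooth]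
      exact mem_zeroSetC_iff.2 hx
    · rw [fromRows_jacC]
      exact hvx

theorem finite_omegaFiber {x : Fin n → ℂ}
    (hx : p + m ≤ (extJac (complexify F) a x).rank + 1) : (omegaFiber F a x).Finite := by
  refine Set.Subsingleton.finite fun w hw u hu => ?_
  rw [omegaFiber, fromRows_jacC, Set.mem_ofPred_eq] at hw hu
  rw [← w.mk_rep, ← u.mk_rep, Projectivization.mk_eq_mk_iff']
  exact Matrix.exists_smul_eq_of_card_le_rank_add_one (by simpa using hx) u.rep_nonzero hu hw

end Rational

/-- Section 3.2 of the paper. Suppose `S` is smooth, `1 ≤ i ≤ n-p`,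
and that for a generic choice of `a` the classic polar variety `W_{K^{n-p-i}(a)}(S)` is
nonempty. Then for a generic choice of `a` (all `a` in a suitable nonempty Zariski open
set of full-rank matrices): the variety `H_i` is nonempty, smooth and equidimensional
of dimension `n-p-i` (its affine cone being of pure dimension `n-p-i+1` and smooth at
all its points); the image of `ω_i : H_i → ℂⁿ` equals
`W_{K^{n-p-i}(a)}(S) ∩ S_reg`; and there is a Zariski dense open subset `U` of
`W_{K^{n-p-i}(a)}(S)` such that the `ω_i`-fiber of every `x ∈ U` is zero-dimensional
(a finite set of projective points). -/
theorem statement10 {n p i : ℕ} (hp1 : 1 ≤ p) (hpn : p ≤ n)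
    (hi1 : 1 ≤ i) (hi2 : i ≤ n - p)
    (F : Fin p → MvPolynomial (Fin n) ℚ)
    (hreg : IsRegSeq (List.ofFn F))
    (hrad : idealOfDef F)
    (hSne : (zeroSetC F).Nonempty)
    (hSdim : IsPureDim (zeroSetC F) (n - p))
    (hsmooth : SregC F = zeroSetC F)
    (hgen : ∃ U : Set (Matrix (Fin (n - p - i + 1)) (Fin n) ℂ),
      ZOpenMat U ∧ U.Nonempty ∧
      ∀ a ∈ U, a.rank = n - p - i + 1 ∧ (Wclassic F a (n - i)).Nonempty) :
    ∃ O : Set (Matrix (Fin (n - p - i + 1)) (Fin n) ℂ),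
      ZOpenMat O ∧ O.Nonempty ∧
      ∀ a ∈ O,
        a.rank = n - p - i + 1 ∧
        (HconeA F a).Nonempty ∧
        IsPureDim (HconeA F a) (n - p - i + 1) ∧
        (∀ q ∈ HconeA F a,
          Module.finrank ℂ ↥(tangentAt (HconeA F a) q) = n - p - i + 1) ∧
        ((fun q (l : Fin n) => q (Sum.inl l)) '' HconeA F a =
          Wclassic F a (n - i) ∩ SregC F) ∧
        ∃ Z : Set (Fin n → ℂ), ZOpen Z ∧
          zcl (Wclassic F a (n - i) ∩ Z) = Wclassic F a (n - i) ∧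
          ∀ x ∈ Wclassic F a (n - i) ∩ Z, (omegaFiber F a x).Finite := by
  have hJ : ∀ x : Fin n → ℂ, (∀ k, eval x (complexify F k) = 0) → ∀ y : Fin p → ℂ,
      (∀ l, ∑ k, y k * eval x (pderiv l (complexify F k)) = 0) → y = 0 := fun x hx y hy =>
    eq_zero_of_mem_SregC (hsmooth ▸ mem_zeroSetC_iff.2 hx) hy
  obtain ⟨U, hU, hUne, hUa⟩ := hgen
  obtain ⟨g, hg, hga⟩ :=
    exists_forall_isTransverse (Fin (n - p - i + 1)) (complexify F) hJ
  obtain ⟨hO, hOne⟩ := hU.exists_inter_ne_zero hUne hg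
  refine ⟨_, hO, hOne, fun a ha => ?_⟩
  obtain ⟨hrank, hW⟩ := hUa a ha.1
  have htr : IsTransverse (complexify F) a := hga a ha.2
  have hT : ∀ q, q ∈ HconeA F a ↔ (∀ k, eval q (coneEq (complexify F) a k) = 0) ∧
      ∃ s, eval q (X (Sum.inr s) : MvPolynomial (Fin n ⊕ (Fin p ⊕ Fin (n - p - i + 1))) ℂ) ≠ 0 :=
    fun q => by
      simp only [mem_HconeA_iff hsmooth, eval_X, ne_eq, funext_iff, not_forall]
      rfl
  have htr' : ∀ q ∈ HconeA F a, ∀ y : Fin p ⊕ Fin n → ℂ,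
      (∀ s, ∑ k, y k * eval q (pderiv s (coneEq (complexify F) a k)) = 0) → y = 0 := fun q hq =>
    htr q ((mem_HconeA_iff hsmooth).1 hq).1 ((mem_HconeA_iff hsmooth).1 hq).2
  have hd : n - p - i + 1 + Fintype.card (Fin p ⊕ Fin n) =
      Fintype.card (Fin n ⊕ (Fin p ⊕ Fin (n - p - i + 1))) := by
    simp only [Fintype.card_sum, Fintype.card_fin]
    omega
  have hWeq : Wclassic F a (n - i) = zcl (polarLocus (complexify F) a) :=
    Wclassic_eq_zcl_polarLocus hsmooth (by omega)
  have hcard : Fintype.card (Fin p ⊕ Fin (n - p - i + 1)) ≤ Fintype.card (Fin n) := by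
    simp only [Fintype.card_sum, Fintype.card_fin]
    omega
  refine ⟨hrank, ?_, isPureDim_of_jacobian hT htr' hd,
    fun q hq => finrank_tangentAt_eq_of_jacobian hT htr' hd hq, ?_, ?_⟩
  · rw [← Set.image_nonempty (f := fun q (l : Fin n) => q (Sum.inl l)), image_HconeA hsmooth,
      Set.nonempty_iff_ne_empty]
    intro h0
    rw [hWeq, h0, zcl_empty] at hW
    exact hW.ne_empty rfl
  · rw [image_HconeA hsmooth, hWeq, hsmooth]
    conv_lhs => rw [← zcl_polarLocus_inter]
    congr 1
    exact Set.ext fun x => mem_zeroSetC_iff.symm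
  · obtain ⟨Z, hZ, hZd, hZr⟩ := htr.exists_zOpen hcard
    rw [hWeq]
    exact ⟨Z, hZ, hZd, fun x hx => finite_omegaFiber (by simpa using hZr x hx.2)⟩
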